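/- arXiv:2410.15070 — 5 statements merged into one kernel-verified Lean document; each statement's English description precedes it below -/
import Mathlib

section
/- Let q = p^s with p prime and s > 1, let 0 < i < s with m = gcd(i, s), and set h = (q − p^i)/2 (an integer, since q and p^i have the same parity). Then D_h contains exactly q^4 codewords (so it has dimension 4 over F_q), the set of Hamming weights of its nonzero codewords is exactly {q − p^m, q − 1, q, q + 1}, and in particular D_h is a four-weight code with parameters [q + 1, 4, q − p^m]. -/
theorem card_pow_eq_self {F : Type*} [Field F] [Fintype F] [DecidableEq F] {p s i : ℕ}
    (hp : p.Prime) (hF : Fintype.card F = p ^ s) (hi : 0 < i) :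
    (Finset.univ.filter fun r : F => r ^ p ^ i = r).card = p ^ Nat.gcd i s := by
  have hP : 1 < p ^ i := Nat.one_lt_pow hi.ne' hp.one_lt
  have hm : 0 < p ^ Nat.gcd i s := pow_pos hp.pos _
  have key := IsCyclic.card_powMonoidHom_ker (G := Fˣ) (p ^ i - 1)
  rw [Nat.card_eq_fintype_card (α := Fˣ), Fintype.card_units, hF,
    Nat.pow_sub_one_gcd_pow_sub_one, Nat.gcd_comm] at key
  have hsplit : (Finset.univ.filter fun r : F => r ^ p ^ i = r) =
      insert 0 ((Finset.univ.filter fun u : Fˣ => u ∈ (powMonoidHom (p ^ i - 1) : Fˣ →* Fˣ).ker).map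
        ⟨Units.val, Units.val_injective⟩) := by
    ext r
    simp only [Finset.mem_filter, Finset.mem_univ, true_and, Finset.mem_insert, Finset.mem_map,
      Function.Embedding.coeFn_mk, MonoidHom.mem_ker, powMonoidHom_apply]
    constructor
    · intro hr
      by_cases h0 : r = 0
      · exact Or.inl h0
      · refine Or.inr ⟨Units.mk0 r h0, ?_, rfl⟩
        ext
        push_cast
        apply mul_right_cancel₀ h0
        rw [Units.val_mk0, ← pow_succ, Nat.sub_add_cancel hP.le, hr, one_mul]
    · rintro (rfl | ⟨u, hu, rfl⟩)
      · exact zero_pow (by omega)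
      · have := congrArg Units.val hu
        push_cast at this
        rw [← Nat.sub_add_cancel hP.le, pow_succ, this, one_mul]
  rw [hsplit, Finset.card_insert_of_notMem (by simp), Finset.card_map]
  rw [Nat.card_eq_fintype_card, Fintype.card_subtype] at key
  rw [key]
  omega

theorem card_zeros_linearized {F : Type*} [Field F] [Fintype F] [DecidableEq F] {p s i : ℕ}
    (hp : p.Prime) (hF : Fintype.card F = p ^ s) (hi : 0 < i) {b c : F} (hbc : b ≠ 0 ∨ c ≠ 0) :
    (Finset.univ.filter fun t : F => b * t ^ p ^ i + c * t = 0).card = 1 ∨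
    (Finset.univ.filter fun t : F => b * t ^ p ^ i + c * t = 0).card = p ^ Nat.gcd i s := by
  have hP : 1 < p ^ i := Nat.one_lt_pow hi.ne' hp.one_lt
  have h00 : (0 : F) ^ p ^ i = 0 := zero_pow (by omega)
  by_cases h : ∃ t : F, t ≠ 0 ∧ b * t ^ p ^ i + c * t = 0
  · right
    obtain ⟨t, ht, h⟩ := h
    have hb : b ≠ 0 := by
      rintro rfl
      simp_all
    rw [← card_pow_eq_self hp hF hi]
    symm
    apply Finset.card_bij (fun r _ => r * t)
    · intro r hr
      simp only [Finset.mem_filter, Finset.mem_univ, true_and] at hr ⊢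
      rw [mul_pow, hr]
      linear_combination r * h
    · intro r _ r' _ e
      exact mul_right_cancel₀ ht e
    · intro r hr
      simp only [Finset.mem_filter, Finset.mem_univ, true_and] at hr ⊢
      refine ⟨r / t, ?_, by field_simp⟩
      have ht' : t ^ p ^ i ≠ 0 := pow_ne_zero _ ht
      rw [div_pow, div_eq_div_iff ht' ht]
      apply mul_left_cancel₀ hb
      linear_combination t * hr - r * h
  · left
    rw [Finset.card_eq_one]
    refine ⟨0, ?_⟩
    ext t
    simp only [Finset.mem_filter, Finset.mem_univ, true_and, Finset.mem_singleton]
    refine ⟨fun ht => by_contra fun h0 => h ⟨t, h0, ht⟩, ?_⟩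
    rintro rfl
    simp [h00]

section

variable {F K : Type*} [Field F] [Field K] [Fintype F] [Fintype K] [Algebra F K] {p s q : ℕ}

theorem algebraMap_trace_quadratic (hF : Fintype.card F = q) (hK : Fintype.card K = q ^ 2) (x : K) :
    algebraMap F K (Algebra.trace F K x) = x + x ^ q := by
  have hq : 1 < q := hF ▸ Fintype.one_lt_card
  have hrank : Module.finrank F K = 2 := by
    have := Module.card_eq_pow_finrank (K := F) (V := K)
    rw [hK, hF] at this
    exact (Nat.pow_right_injective hq this).symm
  rw [FiniteField.algebraMap_trace_eq_sum_pow, hrank, Nat.card_eq_fintype_card, hF]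
  simp [Finset.sum_range_succ]

theorem expChar_of_card_eq_pow (hp : p.Prime) (hK : Fintype.card K = (p ^ s) ^ 2) :
    ExpChar K p := by
  have : Fact p.Prime := ⟨hp⟩
  have : CharP K p := charP_of_card_eq_prime_pow (f := s * 2) (by rw [hK, pow_mul])
  exact ExpChar.prime hp

theorem exists_algebraMap_eq_of_pow_sub_one_eq_one (hp : p.Prime) (hs : 0 < s) (hq : q = p ^ s)
    (hF : Fintype.card F = q) (hK : Fintype.card K = q ^ 2) {x : K} (hx : x ^ (q - 1) = 1) :
    ∃ t : F, algebraMap F K t = x := by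
  classical
  subst hq
  have hpos : 0 < p ^ s := pow_pos hp.pos s
  have hcard := card_pow_eq_self (F := K) (s := s * 2) hp (by rw [hK, pow_mul]) hs
  rw [Nat.gcd_mul_right_right] at hcard
  have hsub : Finset.univ.image (algebraMap F K) ⊆
      Finset.univ.filter fun r : K => r ^ p ^ s = r := by
    intro r hr
    obtain ⟨t, -, rfl⟩ := Finset.mem_image.1 hr
    simp [← map_pow, ← hF, FiniteField.pow_card]
  have heq := Finset.eq_of_subset_of_card_le hsub (by
    rw [hcard, Finset.card_image_of_injective _ (algebraMap F K).injective, Finset.card_univ, hF])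
  have hmem : x ∈ Finset.univ.image (algebraMap F K) := by
    rw [heq]
    simp only [Finset.mem_filter, Finset.mem_univ, true_and]
    rw [← Nat.sub_add_cancel hpos, pow_succ, hx, one_mul]
  obtain ⟨t, -, ht⟩ := Finset.mem_image.1 hmem
  exact ⟨t, ht⟩

variable (F) in
/-- The trace of `v ^ P` times the `F`-linear map `w ↦ a w + b w ^ q`. -/
noncomputable def twistedTrace (P q : ℕ) (a b v w : K) : F :=
  Algebra.trace F K (v ^ P * (a * w + b * w ^ q))

theorem trace_entry_mul (hp : p.Prime) (hq : q = p ^ s)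
    (hF : Fintype.card F = q) (hK : Fintype.card K = q ^ 2) {h P : ℕ} (hh : 2 * h + P = q)
    (a b : K) {u : K} (hu : u ^ (q + 1) = 1) :
    algebraMap F K (Algebra.trace F K (a * u ^ h + b * u ^ (h + 1))) * u ^ (h + 1 + P) =
      a + b * u + a ^ q * u ^ (P + 1) + b ^ q * u ^ P := by
  have := expChar_of_card_eq_pow hp (hq ▸ hK)
  have hadd (x y : K) : (x + y) ^ q = x ^ q + y ^ q := by rw [hq]; exact add_pow_expChar_pow ..
  have e1 : u ^ h * u ^ (h + 1 + P) = 1 := by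
    rw [← pow_add, ← hu]; congr 1; omega
  have e2 : u ^ (h + 1) * u ^ (h + 1 + P) = u := by
    rw [pow_succ]; linear_combination u * e1
  have e3 : (u ^ h) ^ q * u ^ (h + 1 + P) = u ^ (P + 1) := by
    calc _ = (u ^ (q + 1)) ^ h * u ^ (P + 1) := by ring
      _ = _ := by rw [hu, one_pow, one_mul]
  have e4 : (u ^ (h + 1)) ^ q * u ^ (h + 1 + P) = u ^ P := by
    calc _ = (u ^ (q + 1)) ^ (h + 1) * u ^ P := by ring
      _ = _ := by rw [hu, one_pow, one_mul]
  rw [algebraMap_trace_quadratic hF hK, hadd, mul_pow, mul_pow]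
  linear_combination a * e1 + b * e2 + a ^ q * e3 + b ^ q * e4

theorem algebraMap_twistedTrace_self (hp : p.Prime) (hq : q = p ^ s)
    (hF : Fintype.card F = q) (hK : Fintype.card K = q ^ 2) (P : ℕ)
    (a b w : K) {u : K} (hu : w ^ (q - 1) = u) :
    algebraMap F K (twistedTrace F P q a b w w) =
      w ^ (P + 1) * (a + b * u + a ^ q * u ^ (P + 1) + b ^ q * u ^ P) := by
  have := expChar_of_card_eq_pow hp (hq ▸ hK)
  have hpos : 0 < q := hF ▸ Fintype.card_pos
  have hadd (x y : K) : (x + y) ^ q = x ^ q + y ^ q := by rw [hq]; exact add_pow_expChar_pow ..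
  have hw : w ^ q = u * w := by rw [← hu, ← pow_succ, Nat.sub_add_cancel hpos]
  have hww : (u * w) ^ q = w := by rw [← hw, ← pow_mul, ← sq, ← hK, FiniteField.pow_card]
  rw [twistedTrace, algebraMap_trace_quadratic hF hK, mul_pow (w ^ P), hadd, mul_pow a, mul_pow b,
    hw, hww, ← pow_mul, mul_comm P q, pow_mul, hw]
  ring

theorem trace_entry_eq_zero_iff (hp : p.Prime) (hq : q = p ^ s)
    (hF : Fintype.card F = q) (hK : Fintype.card K = q ^ 2) {h P : ℕ} (hh : 2 * h + P = q)
    (a b : K) {u w : K} (hw : w ≠ 0) (hu : w ^ (q - 1) = u) (hu1 : u ^ (q + 1) = 1) :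
    Algebra.trace F K (a * u ^ h + b * u ^ (h + 1)) = 0 ↔ twistedTrace F P q a b w w = 0 := by
  have hu0 : u ≠ 0 := by rintro rfl; simp at hu1
  have h1 := trace_entry_mul hp hq hF hK hh a b hu1
  have h2 := algebraMap_twistedTrace_self hp hq hF hK P a b w hu
  rw [← (map_eq_zero (algebraMap F K)), ← map_eq_zero (algebraMap F K) (a := twistedTrace ..),
    h2, ← h1]
  simp [hw, hu0]

open Polynomial in
theorem eq_zero_of_forall_trace_entry_eq_zero (hp : p.Prime) (hq : q = p ^ s)
    (hF : Fintype.card F = q) (hK : Fintype.card K = q ^ 2) {h P : ℕ} (hh : 2 * h + P = q)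
    (hP : 1 < P) (hPq : P < q) {β : K} (hβ : IsPrimitiveRoot β (q + 1)) {a b : K}
    (hab : ∀ j : Fin (q + 1),
      Algebra.trace F K (a * β ^ (h * (j : ℕ)) + b * β ^ ((h + 1) * (j : ℕ))) = 0) :
    a = 0 ∧ b = 0 := by
  obtain ⟨a', ha'⟩ : ∃ a', a' = a ^ q := ⟨_, rfl⟩
  obtain ⟨b', hb'⟩ : ∃ b', b' = b ^ q := ⟨_, rfl⟩
  let f : K[X] := C a' * X ^ (P + 1) + C b' * X ^ P + C b * X + C a
  have hf : f = 0 := by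
    refine eq_zero_of_natDegree_lt_card_of_eval_eq_zero f
      (f := fun j : Fin (q + 1) => β ^ (j : ℕ)) ?_ ?_ ?_
    · intro j j' e
      exact Fin.ext (hβ.pow_inj j.2 j'.2 e)
    · intro j
      have h1 : (β ^ (j : ℕ)) ^ (q + 1) = 1 := by rw [pow_right_comm, hβ.pow_eq_one, one_pow]
      have := trace_entry_mul hp hq hF hK hh a b h1
      rw [← pow_mul, ← pow_mul, mul_comm _ h, mul_comm _ (h + 1), hab j] at this
      simp only [f, eval_add, eval_mul, eval_C, eval_pow, eval_X]
      rw [map_zero, zero_mul] at this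
      rw [ha', hb']
      linear_combination -this
    · rw [Fintype.card_fin]
      have : f.natDegree ≤ P + 1 := by
        simp only [f]
        compute_degree
      omega
  constructor
  · have := congrArg (coeff · 0) hf
    simpa [f, coeff_X_pow, coeff_X, show P ≠ 0 by omega, show 0 ≠ P by omega] using this
  · have := congrArg (coeff · 1) hf
    simpa [f, coeff_X_pow, coeff_X, coeff_C, show P ≠ 0 by omega, show 1 ≠ P by omega]
      using this

/-- Representatives of the points of the projective line over `F` in terms of a basis of `K`. -/
def linePoint (w₁ w₂ : K) : Option F → K
  | none => w₁
  | some t => algebraMap F K t * w₁ + w₂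

theorem exists_equiv_linePoint (hp : p.Prime) (hs : 0 < s) (hq : q = p ^ s)
    (hF : Fintype.card F = q) (hK : Fintype.card K = q ^ 2)
    {β : K} (hβ : IsPrimitiveRoot β (q + 1)) {w₁ w₂ : K}
    (hw : ∀ x y : F, algebraMap F K x * w₁ + algebraMap F K y * w₂ = 0 → x = 0 ∧ y = 0) :
    ∃ e : Option F ≃ Fin (q + 1), ∀ o, linePoint w₁ w₂ o ≠ 0 ∧
      linePoint w₁ w₂ o ^ (q - 1) = β ^ (e o : ℕ) := by
  have hne (o : Option F) : linePoint w₁ w₂ o ≠ 0 := by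
    intro h0
    rcases o with _ | t
    · simpa using (hw 1 0 (by simpa [linePoint] using h0)).1
    · simpa using (hw t 1 (by simpa [linePoint] using h0)).2
  have hinj (o o' : Option F)
      (h : linePoint w₁ w₂ o ^ (q - 1) = linePoint w₁ w₂ o' ^ (q - 1)) : o = o' := by
    obtain ⟨t, ht⟩ := exists_algebraMap_eq_of_pow_sub_one_eq_one hp hs hq hF hK
      (x := linePoint w₁ w₂ o / linePoint w₁ w₂ o')
      (by rw [div_pow, h, div_self (pow_ne_zero _ (hne o'))])
    rw [eq_div_iff (hne o')] at ht
    rcases o with _ | x <;> rcases o' with _ | y <;> simp only [linePoint] at ht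
    · rfl
    · have := hw (t * y - 1) t (by simp only [map_sub, map_mul, map_one]; linear_combination ht)
      simp [this.2] at this
    · have := hw (t - x) (-1) (by simp only [map_sub, map_neg, map_one]; linear_combination ht)
      simp at this
    · have := hw (t * y - x) (t - 1)
        (by simp only [map_sub, map_mul, map_one]; linear_combination ht)
      obtain ⟨h1, h2⟩ := this
      rw [sub_eq_zero] at h1 h2
      rw [← h1, h2, one_mul]
  have hex (o : Option F) : ∃ j : Fin (q + 1), linePoint w₁ w₂ o ^ (q - 1) = β ^ (j : ℕ) := by
    have : (linePoint w₁ w₂ o ^ (q - 1)) ^ (q + 1) = 1 := by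
      rw [← pow_mul, mul_comm, ← Nat.sq_sub_sq, one_pow, ← hK]
      exact FiniteField.pow_card_sub_one_eq_one _ (hne o)
    obtain ⟨j, hj, h⟩ := hβ.eq_pow_of_pow_eq_one this
    exact ⟨⟨j, hj⟩, h.symm⟩
  choose f hf using hex
  have hf_bij : Function.Bijective f := by
    rw [Fintype.bijective_iff_injective_and_card]
    refine ⟨fun o o' h => hinj o o' (by rw [hf, hf, h]), ?_⟩
    rw [Fintype.card_option, Fintype.card_fin, hF]
  exact ⟨Equiv.ofBijective f hf_bij, fun o => ⟨hne o, hf o⟩⟩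

theorem twistedTrace_add_self (hp : p.Prime) (hq : q = p ^ s)
    (hF : Fintype.card F = q) (hK : Fintype.card K = q ^ 2) (i : ℕ) (a b w₁ w₂ : K) (t : F) :
    twistedTrace F (p ^ i) q a b (algebraMap F K t * w₁ + w₂) (algebraMap F K t * w₁ + w₂) =
      twistedTrace F (p ^ i) q a b w₁ w₁ * t ^ (p ^ i + 1) +
      twistedTrace F (p ^ i) q a b w₁ w₂ * t ^ p ^ i +
      twistedTrace F (p ^ i) q a b w₂ w₁ * t + twistedTrace F (p ^ i) q a b w₂ w₂ := by
  have := expChar_of_card_eq_pow hp (hq ▸ hK)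
  have hadd (n : ℕ) (x y : K) : (x + y) ^ p ^ n = x ^ p ^ n + y ^ p ^ n := add_pow_expChar_pow ..
  have ht : algebraMap F K t ^ p ^ s = algebraMap F K t := by
    rw [← hq, ← hF, ← map_pow, FiniteField.pow_card]
  have hsm (x : F) (y : K) : Algebra.trace F K y * x = Algebra.trace F K (algebraMap F K x * y) := by
    rw [← Algebra.smul_def, map_smul, smul_eq_mul, mul_comm]
  simp only [twistedTrace, hsm, ← map_add]
  congr 1
  subst hq
  rw [hadd, hadd, mul_pow, mul_pow, ht, map_pow, map_pow]
  ring

theorem card_zeros_entry [DecidableEq F] (hp : p.Prime) (hs : 0 < s) (hq : q = p ^ s)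
    (hF : Fintype.card F = q) (hK : Fintype.card K = q ^ 2) {h i : ℕ} (hh : 2 * h + p ^ i = q)
    {β : K} (hβ : IsPrimitiveRoot β (q + 1)) {w₁ w₂ : K}
    (hw : ∀ x y : F, algebraMap F K x * w₁ + algebraMap F K y * w₂ = 0 → x = 0 ∧ y = 0)
    (a b : K) :
    (Finset.univ.filter fun j : Fin (q + 1) =>
      Algebra.trace F K (a * β ^ (h * (j : ℕ)) + b * β ^ ((h + 1) * (j : ℕ))) = 0).card =
    (Finset.univ.filter fun t : F => twistedTrace F (p ^ i) q a b w₁ w₁ * t ^ (p ^ i + 1) +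
      twistedTrace F (p ^ i) q a b w₁ w₂ * t ^ p ^ i +
      twistedTrace F (p ^ i) q a b w₂ w₁ * t + twistedTrace F (p ^ i) q a b w₂ w₂ = 0).card +
    if twistedTrace F (p ^ i) q a b w₁ w₁ = 0 then 1 else 0 := by
  obtain ⟨e, he⟩ := exists_equiv_linePoint hp hs hq hF hK hβ hw
  have hiff (o : Option F) : Algebra.trace F K
      (a * β ^ (h * (e o : ℕ)) + b * β ^ ((h + 1) * (e o : ℕ))) = 0 ↔
      twistedTrace F (p ^ i) q a b (linePoint w₁ w₂ o) (linePoint w₁ w₂ o) = 0 := by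
    rw [mul_comm h, mul_comm (h + 1), pow_mul, pow_mul]
    refine trace_entry_eq_zero_iff hp hq hF hK hh a b (he o).1 (he o).2 ?_
    rw [pow_right_comm, hβ.pow_eq_one, one_pow]
  simp only [Finset.card_filter]
  rw [← e.sum_comp, Fintype.sum_option, add_comm]
  simp only [hiff, linePoint, twistedTrace_add_self hp hq hF hK]

end

section

variable {F K : Type*} [Field F] [Field K] [Fintype F] [Fintype K] [Algebra F K]
  [DecidableEq F] {p s q : ℕ}

theorem exists_independent_pair (hF : Fintype.card F = q) (hK : Fintype.card K = q ^ 2) :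
    ∃ w₁ w₂ : K, ∀ x y : F,
      algebraMap F K x * w₁ + algebraMap F K y * w₂ = 0 → x = 0 ∧ y = 0 := by
  have hq : 1 < q := hF ▸ Fintype.one_lt_card
  have hns : ¬ Function.Surjective (algebraMap F K) := by
    intro hs
    have := Fintype.card_le_of_surjective _ hs
    rw [hF, hK] at this
    nlinarith
  simp only [Function.Surjective, not_forall, not_exists] at hns
  obtain ⟨w, hw⟩ := hns
  refine ⟨w, 1, fun x y hxy => ?_⟩
  have hx : x = 0 := by
    by_contra hx
    have hx' : algebraMap F K x ≠ 0 := by simpa using hx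
    apply hw (-y / x)
    rw [map_div₀, map_neg, div_eq_iff hx']
    linear_combination -hxy
  subst hx
  simpa using hxy

theorem eq_zero_of_twistedTrace_eq_zero (hp : p.Prime) (hs : 0 < s) (hq : q = p ^ s)
    (hF : Fintype.card F = q) (hK : Fintype.card K = q ^ 2) {h i : ℕ} (hh : 2 * h + p ^ i = q)
    (hi : 0 < i) (his : i < s)
    {β : K} (hβ : IsPrimitiveRoot β (q + 1)) {w₁ w₂ : K}
    (hw : ∀ x y : F, algebraMap F K x * w₁ + algebraMap F K y * w₂ = 0 → x = 0 ∧ y = 0)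
    {a b : K} (h₁₁ : twistedTrace F (p ^ i) q a b w₁ w₁ = 0)
    (h₁₂ : twistedTrace F (p ^ i) q a b w₁ w₂ = 0) (h₂₁ : twistedTrace F (p ^ i) q a b w₂ w₁ = 0)
    (h₂₂ : twistedTrace F (p ^ i) q a b w₂ w₂ = 0) : a = 0 ∧ b = 0 := by
  have hc := card_zeros_entry hp hs hq hF hK hh hβ hw a b
  simp only [h₁₁, h₁₂, h₂₁, h₂₂, zero_mul, add_zero, Finset.filter_true, if_true,
    Finset.card_univ, hF] at hc
  have hall : _ = Finset.univ := Finset.eq_univ_of_card _ (hc.trans (Fintype.card_fin _).symm)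
  refine eq_zero_of_forall_trace_entry_eq_zero hp hq hF hK hh (Nat.one_lt_pow hi.ne' hp.one_lt)
    (hq ▸ Nat.pow_lt_pow_right hp.one_lt his) hβ fun j => ?_
  have := hall ▸ Finset.mem_univ j
  exact (Finset.mem_filter.1 this).2

theorem exists_twistedTrace_eq (hp : p.Prime) (hs : 0 < s) (hq : q = p ^ s)
    (hF : Fintype.card F = q) (hK : Fintype.card K = q ^ 2) {h i : ℕ} (hh : 2 * h + p ^ i = q)
    (hi : 0 < i) (his : i < s)
    {β : K} (hβ : IsPrimitiveRoot β (q + 1)) {w₁ w₂ : K}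
    (hw : ∀ x y : F, algebraMap F K x * w₁ + algebraMap F K y * w₂ = 0 → x = 0 ∧ y = 0)
    (c₁₁ c₁₂ c₂₁ c₂₂ : F) : ∃ a b : K,
      twistedTrace F (p ^ i) q a b w₁ w₁ = c₁₁ ∧ twistedTrace F (p ^ i) q a b w₁ w₂ = c₁₂ ∧
      twistedTrace F (p ^ i) q a b w₂ w₁ = c₂₁ ∧ twistedTrace F (p ^ i) q a b w₂ w₂ = c₂₂ := by
  let φ : K × K → F × F × F × F := fun x =>
    (twistedTrace F (p ^ i) q x.1 x.2 w₁ w₁, twistedTrace F (p ^ i) q x.1 x.2 w₁ w₂,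
      twistedTrace F (p ^ i) q x.1 x.2 w₂ w₁, twistedTrace F (p ^ i) q x.1 x.2 w₂ w₂)
  have hsub (a b a' b' v w : K) : twistedTrace F (p ^ i) q (a - a') (b - b') v w =
      twistedTrace F (p ^ i) q a b v w - twistedTrace F (p ^ i) q a' b' v w := by
    simp only [twistedTrace, ← map_sub]
    congr 1
    ring
  have hφ : Function.Bijective φ := by
    rw [Fintype.bijective_iff_injective_and_card]
    constructor
    · rintro ⟨a, b⟩ ⟨a', b'⟩ e
      simp only [φ, Prod.mk.injEq] at e
      obtain ⟨e₁, e₂, e₃, e₄⟩ := e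
      have := eq_zero_of_twistedTrace_eq_zero hp hs hq hF hK hh hi his hβ hw
        (a := a - a') (b := b - b') (by rw [hsub, e₁, sub_self]) (by rw [hsub, e₂, sub_self])
        (by rw [hsub, e₃, sub_self]) (by rw [hsub, e₄, sub_self])
      rw [sub_eq_zero, sub_eq_zero] at this
      rw [this.1, this.2]
    · simp only [Fintype.card_prod, hF, hK]
      ring
  obtain ⟨⟨a, b⟩, hab⟩ := hφ.2 (c₁₁, c₁₂, c₂₁, c₂₂)
  simp only [φ, Prod.mk.injEq] at hab
  exact ⟨a, b, hab⟩

theorem card_zeros_entry_mem (hp : p.Prime) (hs : 0 < s) (hq : q = p ^ s)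
    (hF : Fintype.card F = q) (hK : Fintype.card K = q ^ 2) {h i : ℕ} (hh : 2 * h + p ^ i = q)
    (hi : 0 < i) (his : i < s)
    {β : K} (hβ : IsPrimitiveRoot β (q + 1)) {a b : K} (hab : ¬ (a = 0 ∧ b = 0)) :
    (Finset.univ.filter fun j : Fin (q + 1) =>
      Algebra.trace F K (a * β ^ (h * (j : ℕ)) + b * β ^ ((h + 1) * (j : ℕ))) = 0).card ∈
    ({0, 1, 2, p ^ Nat.gcd i s + 1} : Set ℕ) := by
  obtain ⟨v₁, v₂, hv⟩ := exists_independent_pair hF hK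
  obtain ⟨e, he⟩ := exists_equiv_linePoint hp hs hq hF hK hβ hv
  by_cases hN : 1 < (Finset.univ.filter fun j : Fin (q + 1) =>
      Algebra.trace F K (a * β ^ (h * (j : ℕ)) + b * β ^ ((h + 1) * (j : ℕ))) = 0).card
  swap
  · simp only [Set.mem_insert_iff, Set.mem_singleton_iff]
    omega
  obtain ⟨j₁, hj₁, j₂, hj₂, hne⟩ := Finset.one_lt_card.1 hN
  have hrep (j : Fin (q + 1)) (hj : j ∈ Finset.univ.filter fun j : Fin (q + 1) =>
      Algebra.trace F K (a * β ^ (h * (j : ℕ)) + b * β ^ ((h + 1) * (j : ℕ))) = 0) :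
      ∃ w : K, w ≠ 0 ∧ w ^ (q - 1) = β ^ (j : ℕ) ∧ twistedTrace F (p ^ i) q a b w w = 0 := by
    have hj' := he (e.symm j)
    rw [e.apply_symm_apply] at hj'
    refine ⟨_, hj'.1, hj'.2, ?_⟩
    rw [← trace_entry_eq_zero_iff hp hq hF hK hh a b hj'.1 hj'.2
      (by rw [pow_right_comm, hβ.pow_eq_one, one_pow]), ← pow_mul, ← pow_mul, mul_comm _ h,
      mul_comm _ (h + 1)]
    exact (Finset.mem_filter.1 hj).2
  obtain ⟨w₁, hw₁, hu₁, h₁₁⟩ := hrep j₁ hj₁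
  obtain ⟨w₂, hw₂, hu₂, h₂₂⟩ := hrep j₂ hj₂
  have hind : ∀ x y : F, algebraMap F K x * w₁ + algebraMap F K y * w₂ = 0 → x = 0 ∧ y = 0 := by
    intro x y hxy
    have hx : x = 0 := by
      by_contra hx
      have hx' : algebraMap F K x ≠ 0 := by simpa using hx
      have hy : y ≠ 0 := by
        rintro rfl
        rw [map_zero, zero_mul, add_zero] at hxy
        exact mul_ne_zero hx' hw₁ hxy
      have h1 : algebraMap F K x * w₁ = algebraMap F K (-y) * w₂ := by
        rw [map_neg]
        linear_combination hxy
      have hone (z : F) (hz : z ≠ 0) : algebraMap F K z ^ (q - 1) = 1 := by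
        rw [← map_pow, ← hF, FiniteField.pow_card_sub_one_eq_one z hz, map_one]
      have h2 := congrArg (· ^ (q - 1)) h1
      simp only [mul_pow, hone x hx, hone (-y) (neg_ne_zero.2 hy), one_mul, hu₁, hu₂] at h2
      exact hne (Fin.ext (hβ.pow_inj j₁.2 j₂.2 h2))
    subst hx
    simpa [hw₂] using hxy
  rw [card_zeros_entry hp hs hq hF hK hh hβ hind a b]
  have hbc : twistedTrace F (p ^ i) q a b w₁ w₂ ≠ 0 ∨ twistedTrace F (p ^ i) q a b w₂ w₁ ≠ 0 := by
    by_contra! hcon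
    exact hab (eq_zero_of_twistedTrace_eq_zero hp hs hq hF hK hh hi his hβ hind h₁₁ hcon.1
      hcon.2 h₂₂)
  simp only [h₁₁, h₂₂, zero_mul, zero_add, add_zero, if_true]
  rcases card_zeros_linearized hp (hF.trans hq) hi hbc with hc | hc <;> simp [hc]

theorem exists_card_zeros_entry_eq (hp : p.Prime) (hs : 0 < s) (hq : q = p ^ s)
    (hF : Fintype.card F = q) (hK : Fintype.card K = q ^ 2) {h i : ℕ} (hh : 2 * h + p ^ i = q)
    (hi : 0 < i) (his : i < s)
    {β : K} (hβ : IsPrimitiveRoot β (q + 1)) {n : ℕ}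
    (hn : n ∈ ({0, 1, 2, p ^ Nat.gcd i s + 1} : Set ℕ)) : ∃ a b : K,
    (Finset.univ.filter fun j : Fin (q + 1) =>
      Algebra.trace F K (a * β ^ (h * (j : ℕ)) + b * β ^ ((h + 1) * (j : ℕ))) = 0).card = n := by
  obtain ⟨w₁, w₂, hw⟩ := exists_independent_pair hF hK
  suffices ∃ c₁₁ c₁₂ c₂₁ c₂₂ : F, (Finset.univ.filter fun t : F =>
      c₁₁ * t ^ (p ^ i + 1) + c₁₂ * t ^ p ^ i + c₂₁ * t + c₂₂ = 0).card +
      (if c₁₁ = 0 then 1 else 0) = n by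
    obtain ⟨c₁₁, c₁₂, c₂₁, c₂₂, hc⟩ := this
    obtain ⟨a, b, h₁, h₂, h₃, h₄⟩ :=
      exists_twistedTrace_eq hp hs hq hF hK hh hi his hβ hw c₁₁ c₁₂ c₂₁ c₂₂
    refine ⟨a, b, ?_⟩
    rw [card_zeros_entry hp hs hq hF hK hh hβ hw a b, h₁, h₂, h₃, h₄, hc]
  have hP : p ^ i ≠ 0 := pow_ne_zero _ hp.ne_zero
  rcases hn with rfl | rfl | rfl | rfl
  · have hninj : ¬ Function.Injective fun t : F => t ^ (p ^ i + 1) - t := fun hinj =>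
      one_ne_zero (@hinj 1 0 (by simp))
    have hnsurj : ¬ Function.Surjective fun t : F => t ^ (p ^ i + 1) - t := fun hsurj =>
      hninj (Finite.injective_iff_surjective.2 hsurj)
    simp only [Function.Surjective, not_forall, not_exists] at hnsurj
    obtain ⟨d, hd⟩ := hnsurj
    refine ⟨1, 0, -1, -d, ?_⟩
    rw [if_neg one_ne_zero, add_zero, Finset.card_eq_zero, Finset.filter_eq_empty_iff]
    intro t _ ht
    apply hd t
    linear_combination ht
  · exact ⟨1, 0, 0, 0, by simp [Finset.filter_eq']⟩
  · exact ⟨0, 1, 0, 0, by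
      simp only [pow_eq_zero_iff hP, one_mul, zero_mul, zero_add, add_zero, Finset.filter_eq']
      simp⟩
  · refine ⟨0, 1, -1, 0, ?_⟩
    rw [← card_pow_eq_self hp (hF.trans hq) hi]
    simp [← sub_eq_add_neg, sub_eq_zero]

end

theorem stmt2 (p s : ℕ) (hp : p.Prime) (hs : 1 < s) (q : ℕ) (hq : q = p ^ s)
    (i m : ℕ) (hi0 : 0 < i) (his : i < s) (hm : m = Nat.gcd i s)
    (h : ℕ) (hh : 2 * h = q - p ^ i)
    (F K : Type) [Field F] [Field K] [Fintype F] [Fintype K] [DecidableEq F]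
    [Algebra F K] (hF : Fintype.card F = q) (hK : Fintype.card K = q ^ 2)
    (β : K) (hβ : IsPrimitiveRoot β (q + 1))
    (D : Set (Fin (q + 1) → F))
    (hD : D = {c | ∃ a b : K, ∀ j : Fin (q + 1),
      c j = Algebra.trace F K (a * β ^ (h * (j : ℕ)) + b * β ^ ((h + 1) * (j : ℕ)))}) :
    D.ncard = q ^ 4 ∧
    {w : ℕ | ∃ c ∈ D, c ≠ 0 ∧ hammingNorm c = w} =
      {q - p ^ m, q - 1, q, q + 1} := by
  have hPq : p ^ i < q := hq ▸ Nat.pow_lt_pow_right hp.one_lt his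
  have hh' : 2 * h + p ^ i = q := by omega
  have hs0 : 0 < s := by omega
  have hmq : p ^ m < q := by
    rw [hq, hm]
    exact Nat.pow_lt_pow_right hp.one_lt ((Nat.gcd_le_left s hi0).trans_lt his)
  have hm1 : 0 < p ^ m := pow_pos hp.pos m
  have hP1 : 1 < p ^ i := Nat.one_lt_pow hi0.ne' hp.one_lt
  let φ : K × K → Fin (q + 1) → F := fun x j =>
    Algebra.trace F K (x.1 * β ^ (h * (j : ℕ)) + x.2 * β ^ ((h + 1) * (j : ℕ)))
  have hDφ : D = Set.range φ := by
    rw [hD]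
    ext c
    simp only [Set.mem_ofPred_eq, Set.mem_range, Prod.exists, φ, funext_iff, eq_comm]
  have hnorm (c : Fin (q + 1) → F) :
      (Finset.univ.filter fun j => c j = 0).card + hammingNorm c = q + 1 := by
    rw [hammingNorm, Finset.card_filter_add_card_filter_not, Finset.card_univ, Fintype.card_fin]
  constructor
  · have hφ : Function.Injective φ := by
      rintro ⟨a, b⟩ ⟨a', b'⟩ e
      have := eq_zero_of_forall_trace_entry_eq_zero hp hq hF hK hh' hP1 hPq hβ
        (a := a - a') (b := b - b') fun j => by
          have := congrFun e j
          simp only [φ] at this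
          rw [← sub_eq_zero, ← map_sub] at this
          rw [← this]
          congr 1
          ring
      rw [sub_eq_zero, sub_eq_zero] at this
      rw [this.1, this.2]
    rw [hDφ, ← Set.image_univ, Set.ncard_image_of_injective _ hφ, Set.ncard_univ,
      Nat.card_eq_fintype_card, Fintype.card_prod, hK]
    ring
  · ext w
    rw [hDφ]
    constructor
    · rintro ⟨_, ⟨⟨a, b⟩, rfl⟩, hc, rfl⟩
      have hab : ¬ (a = 0 ∧ b = 0) := by
        rintro ⟨rfl, rfl⟩
        exact hc (by ext; simp [φ])
      have h1 := card_zeros_entry_mem hp hs0 hq hF hK hh' hi0 his hβ hab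
      have h2 := hnorm (φ (a, b))
      simp only [φ, Set.mem_insert_iff, Set.mem_singleton_iff, ← hm] at h1 h2 ⊢
      omega
    · intro hw
      obtain ⟨a, b, hab⟩ := exists_card_zeros_entry_eq hp hs0 hq hF hK hh' hi0 his hβ
        (n := q + 1 - w) (by
          simp only [Set.mem_insert_iff, Set.mem_singleton_iff, ← hm] at hw ⊢
          omega)
      have h2 := hnorm (φ (a, b))
      have hw' : hammingNorm (φ (a, b)) = w := by
        simp only [φ, Set.mem_insert_iff, Set.mem_singleton_iff] at hw h2 ⊢
        omega
      refine ⟨_, ⟨(a, b), rfl⟩, ?_, hw'⟩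
      rw [← hammingNorm_ne_zero_iff, hw']
      simp only [Set.mem_insert_iff, Set.mem_singleton_iff] at hw
      omega
end

section
/- Let q = 2^s with s > 1 an integer, let 0 < i < s with gcd(i, s) = 1, and set h = (q − 2^i)/2. Then the BCH code C_h is an MDS code with parameters [q + 1, q − 3, 5]: it contains exactly q^{q−3} codewords and its minimum distance is 5. Moreover, its dual code D_h has parameters [q + 1, 4, q − 2]: it contains exactly q^4 codewords and its minimum distance is q − 2. -/
section GeneralPosition

variable {ι F V : Type*} [Field F] [AddCommGroup V] [Module F V]

/-- A family of vectors is in `k`-general position if every `k` of its members, taken at distinct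
indices, are linearly independent. -/
def InGeneralPosition (F : Type*) [Field F] [Module F V] (k : ℕ) (g : ι → V) : Prop :=
  ∀ S : Finset ι, S.card = k → LinearIndepOn F g (S : Set ι)

namespace InGeneralPosition

variable {k : ℕ} {g : ι → V}

theorem span_image_eq_top [FiniteDimensional F V] (hg : InGeneralPosition F k g)
    (hV : Module.finrank F V = k) {S : Finset ι} (hS : S.card = k) :
    Submodule.span F (g '' S) = ⊤ := by
  have := LinearIndependent.span_eq_top_of_card_eq_finrank' (hg S hS) (by simp [hS, hV])
  rwa [← Set.image_eq_range g (S : Set ι)] at this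

theorem dual_eq_zero [FiniteDimensional F V] (hg : InGeneralPosition F k g)
    (hV : Module.finrank F V = k) {S : Finset ι} (hS : k ≤ S.card) {φ : Module.Dual F V}
    (hφ : ∀ j ∈ S, φ (g j) = 0) : φ = 0 := by
  obtain ⟨T, hTS, hT⟩ := Finset.exists_subset_card_eq hS
  refine LinearMap.ext_on (hg.span_image_eq_top hV hT) ?_
  rintro _ ⟨j, hj, rfl⟩
  exact hφ j (hTS hj)

variable [Fintype ι]

theorem eq_zero_of_hammingNorm_le [DecidableEq F] (hg : InGeneralPosition F k g)
    (hk : k ≤ Fintype.card ι) {c : ι → F} (hc : ∑ j, c j • g j = 0) (hw : hammingNorm c ≤ k) :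
    c = 0 := by
  obtain ⟨S, hS, hSk⟩ := Finset.exists_superset_card_eq hw hk
  have hout : ∀ j ∉ S, c j = 0 := fun j hj => by
    by_contra hne
    exact hj (hS (by simpa using hne))
  have hsum : ∑ j ∈ S, c j • g j = 0 := by
    rw [← hc]
    exact Finset.sum_subset (Finset.subset_univ S) fun j _ hj => by simp [hout j hj]
  funext j
  by_cases hj : j ∈ S
  · exact linearIndepOn_finset_iff.1 (hg S hSk) c hsum j hj
  · exact hout j hj

/-- The code with parity check columns `g` is MDS, of minimum distance `k + 1`. -/
theorem isLeast_hammingNorm_ker [DecidableEq F] [FiniteDimensional F V]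
    (hg : InGeneralPosition F k g) (hV : Module.finrank F V = k) (hk : k < Fintype.card ι) :
    IsLeast {w : ℕ | ∃ c : ι → F, ∑ j, c j • g j = 0 ∧ c ≠ 0 ∧ hammingNorm c = w} (k + 1) := by
  classical
  have hlow : ∀ c : ι → F, ∑ j, c j • g j = 0 → c ≠ 0 → k + 1 ≤ hammingNorm c := by
    intro c hc hne
    by_contra! hlt
    exact hne (hg.eq_zero_of_hammingNorm_le hk.le hc (by omega))
  refine ⟨?_, fun w ⟨c, hc, hne, hw⟩ => hw ▸ hlow c hc hne⟩
  obtain ⟨T, -, hT⟩ := Finset.exists_subset_card_eq (s := (Finset.univ : Finset ι))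
    (n := k + 1) (by simpa using hk)
  have hdep : ¬ LinearIndepOn F g (T : Set ι) := fun hli => by
    have := LinearIndependent.fintype_card_le_finrank hli
    simp only [Finset.coe_sort_coe, Fintype.card_coe] at this
    omega
  rw [linearIndepOn_finset_iff] at hdep
  push Not at hdep
  obtain ⟨f, hf, j₀, hj₀, hne⟩ := hdep
  let c : ι → F := fun j => if j ∈ T then f j else 0
  have hc : ∑ j, c j • g j = 0 := by
    simpa [c, ite_smul, Finset.sum_ite_mem] using hf
  have hc0 : c ≠ 0 := fun h0 => hne (by simpa [c, hj₀] using congrFun h0 j₀)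
  refine ⟨c, hc, hc0, le_antisymm ?_ (hlow c hc hc0)⟩
  rw [← hT]
  refine Finset.card_le_card fun j hj => ?_
  by_contra hjT
  simp [c, hjT] at hj

theorem ncard_ker [FiniteDimensional F V] [Fintype F] (hg : InGeneralPosition F k g)
    (hV : Module.finrank F V = k) (hk : k ≤ Fintype.card ι) :
    {c : ι → F | ∑ j, c j • g j = 0}.ncard = Fintype.card F ^ (Fintype.card ι - k) := by
  classical
  obtain ⟨S, -, hS⟩ := Finset.exists_subset_card_eq (s := (Finset.univ : Finset ι)) (n := k)
    (by simpa using hk)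
  have hrange : LinearMap.range (Fintype.linearCombination F g) = ⊤ := by
    rw [Fintype.range_linearCombination, eq_top_iff, ← hg.span_image_eq_top hV hS]
    exact Submodule.span_mono (Set.image_subset_range _ _)
  have hfin := LinearMap.finrank_range_add_finrank_ker (Fintype.linearCombination F g)
  rw [hrange, finrank_top, hV, Module.finrank_fintype_fun_eq_card] at hfin
  have hset : {c : ι → F | ∑ j, c j • g j = 0} =
      (LinearMap.ker (Fintype.linearCombination F g) : Set (ι → F)) := by
    ext c
    simp [Fintype.linearCombination_apply]
  rw [hset, ← Nat.card_coe_set_eq, SetLike.coe_sort_coe, Module.natCard_eq_pow_finrank (K := F),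
    Nat.card_eq_fintype_card]
  congr 1
  omega

theorem ncard_dual [FiniteDimensional F V] [Fintype F] (hg : InGeneralPosition F k g)
    (hV : Module.finrank F V = k) (hk : k ≤ Fintype.card ι) :
    {c : ι → F | ∃ φ : Module.Dual F V, ∀ j, c j = φ (g j)}.ncard = Fintype.card F ^ k := by
  let T : Module.Dual F V →ₗ[F] (ι → F) := LinearMap.pi fun j => Module.Dual.eval F V (g j)
  have hinj : Function.Injective T := by
    rw [← LinearMap.ker_eq_bot, LinearMap.ker_eq_bot']
    intro φ hφ
    exact hg.dual_eq_zero hV (S := Finset.univ) (by simpa using hk) fun j _ => congrFun hφ j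
  have hset : {c : ι → F | ∃ φ : Module.Dual F V, ∀ j, c j = φ (g j)} = Set.range T := by
    ext c
    exact exists_congr fun φ => ⟨fun h => funext fun j => (h j).symm, fun h j => by rw [← h]; rfl⟩
  rw [hset, Set.ncard_range_of_injective hinj, Module.natCard_eq_pow_finrank (K := F),
    Subspace.dual_finrank_eq, hV, Nat.card_eq_fintype_card]

/-- The code generated by the coordinates of `g` is MDS, of minimum distance `card ι - k + 1`. -/
theorem isLeast_hammingNorm_dual [DecidableEq F] [FiniteDimensional F V]
    (hg : InGeneralPosition F k g) (hV : Module.finrank F V = k) (hk0 : 0 < k)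
    (hk : k ≤ Fintype.card ι) :
    IsLeast {w : ℕ | ∃ c : ι → F, (∃ φ : Module.Dual F V, ∀ j, c j = φ (g j)) ∧ c ≠ 0 ∧
      hammingNorm c = w} (Fintype.card ι - k + 1) := by
  classical
  have hcard : ∀ c : ι → F,
      (Finset.univ.filter fun j => c j = 0).card + hammingNorm c = Fintype.card ι := fun c => by
    simpa [hammingNorm] using
      Finset.card_filter_add_card_filter_not (s := Finset.univ) fun j => c j = 0
  have hlow : ∀ c : ι → F, (∃ φ : Module.Dual F V, ∀ j, c j = φ (g j)) → c ≠ 0 →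
      Fintype.card ι - k + 1 ≤ hammingNorm c := by
    rintro c ⟨φ, hφ⟩ hne
    by_contra! hlt
    have hφ0 : φ = 0 := hg.dual_eq_zero hV (S := Finset.univ.filter fun j => c j = 0)
      (by have := hcard c; omega) fun j hj => by rw [← hφ]; simpa using hj
    exact hne (funext fun j => by simp [hφ, hφ0])
  refine ⟨?_, fun w ⟨c, hc, hne, hw⟩ => hw ▸ hlow c hc hne⟩
  obtain ⟨T, -, hT⟩ := Finset.exists_subset_card_eq (s := (Finset.univ : Finset ι))
    (n := k - 1) (by rw [Finset.card_univ]; omega)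
  have hlt : Submodule.span F (g '' T) < ⊤ := by
    refine lt_top_iff_ne_top.2 fun htop => ?_
    have hle := finrank_span_finset_le_card (R := F) (T.image g)
    rw [Set.finrank, Finset.coe_image, htop, finrank_top, hV] at hle
    have := Finset.card_image_le (s := T) (f := g)
    omega
  obtain ⟨φ, hφ0, hφ⟩ := Submodule.exists_le_ker_of_lt_top _ hlt
  let c : ι → F := fun j => φ (g j)
  have hc0 : c ≠ 0 := fun h0 => hφ0 <|
    hg.dual_eq_zero hV (S := Finset.univ) (by simpa using hk) fun j _ => congrFun h0 j
  refine ⟨c, ⟨φ, fun _ => rfl⟩, hc0, le_antisymm ?_ (hlow c ⟨φ, fun _ => rfl⟩ hc0)⟩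
  have hsub : T ⊆ Finset.univ.filter fun j => c j = 0 := fun j hj => by
    simpa [c] using hφ (Submodule.subset_span ⟨j, hj, rfl⟩)
  have := Finset.card_le_card hsub
  have := hcard c
  omega

end InGeneralPosition

end GeneralPosition

theorem det_one_self_other_mul {R : Type*} [CommRing R] (u v : Fin 4 → R) :
    (Matrix.of fun k => ![1, u k, v k, u k * v k]).det =
      (u 0 - u 1) * (u 2 - u 3) * ((v 0 - v 2) * (v 1 - v 3)) -
        (u 0 - u 2) * (u 1 - u 3) * ((v 0 - v 1) * (v 2 - v 3)) := by
  simp [Matrix.det_succ_row_zero, Fin.sum_univ_succ, Fin.succAbove]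
  ring

/-- In characteristic two, an element fixed by two coprime powers of Frobenius is `0` or `1`. -/
theorem eq_zero_or_one_of_pow_two_pow_eq {K : Type*} [Field K] {i s : ℕ} (his : Nat.gcd i s = 1)
    {x : K} (hi : x ^ 2 ^ i = x) (hs : x ^ 2 ^ s = x) : x = 0 ∨ x = 1 := by
  have key : ∀ n, Function.IsPeriodicPt (fun y : K => y ^ 2) n x ↔ x ^ 2 ^ n = x := fun n => by
    rw [Function.IsPeriodicPt, Function.IsFixedPt, pow_iterate]
  have h1 := ((key i).2 hi).gcd ((key s).2 hs)
  rw [his, key, pow_one] at h1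
  have h2 : x * (x - 1) = 0 := by linear_combination h1
  rcases mul_eq_zero.1 h2 with h | h
  · exact Or.inl h
  · exact Or.inr (sub_eq_zero.1 h)

/-- Four distinct points with `u ^ (2 ^ s + 1) = 1` have their cross-ratio fixed by the `2 ^ s`-th
power map; if the determinant vanished, it would also be fixed by the `2 ^ i`-th power map. -/
theorem det_pow_ne_zero {K : Type*} [Field K] [CharP K 2] {i s : ℕ} (his : Nat.gcd i s = 1)
    {u : Fin 4 → K} (hinj : Function.Injective u) (hu : ∀ k, u k ^ (2 ^ s + 1) = 1) :
    (Matrix.of fun k => ![1, u k, u k ^ 2 ^ i, u k * u k ^ 2 ^ i]).det ≠ 0 := by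
  have : Fact (Nat.Prime 2) := ⟨Nat.prime_two⟩
  intro hdet
  rw [det_one_self_other_mul u fun k => u k ^ 2 ^ i] at hdet
  have hne : ∀ {a b : Fin 4}, a ≠ b → u a - u b ≠ 0 := fun hab => sub_ne_zero.2 (hinj.ne hab)
  have h01 := hne (a := 0) (b := 1) (by decide)
  have h23 := hne (a := 2) (b := 3) (by decide)
  have h02 := hne (a := 0) (b := 2) (by decide)
  have h13 := hne (a := 1) (b := 3) (by decide)
  have h03 := hne (a := 0) (b := 3) (by decide)
  have h12 := hne (a := 1) (b := 2) (by decide)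
  simp only [← sub_pow_char_pow, ← mul_pow] at hdet
  have hu0 : ∀ k, u k ≠ 0 := fun k h0 => by simpa [h0] using hu k
  have hinv : ∀ k, u k ^ 2 ^ s = (u k)⁻¹ := fun k => by
    exact eq_inv_of_mul_eq_one_left (by rw [← pow_succ, hu k])
  have hfix_i : ((u 0 - u 1) * (u 2 - u 3) / ((u 0 - u 2) * (u 1 - u 3))) ^ 2 ^ i =
      (u 0 - u 1) * (u 2 - u 3) / ((u 0 - u 2) * (u 1 - u 3)) := by
    rw [div_pow, div_eq_div_iff (pow_ne_zero _ (mul_ne_zero h02 h13)) (mul_ne_zero h02 h13)]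
    linear_combination -hdet
  have hfix_s : ((u 0 - u 1) * (u 2 - u 3) / ((u 0 - u 2) * (u 1 - u 3))) ^ 2 ^ s =
      (u 0 - u 1) * (u 2 - u 3) / ((u 0 - u 2) * (u 1 - u 3)) := by
    rw [div_pow, div_eq_div_iff (pow_ne_zero _ (mul_ne_zero h02 h13)) (mul_ne_zero h02 h13)]
    simp only [mul_pow, sub_pow_char_pow, hinv]
    have := hu0 0
    have := hu0 1
    have := hu0 2
    have := hu0 3
    field_simp
    ring
  rcases eq_zero_or_one_of_pow_two_pow_eq his hfix_i hfix_s with h | h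
  · exact div_ne_zero (mul_ne_zero h01 h23) (mul_ne_zero h02 h13) h
  · rw [div_eq_one_iff_eq (mul_ne_zero h02 h13)] at h
    exact mul_ne_zero h03 h12 (by linear_combination -h)

theorem inGeneralPosition_zeros {s i h : ℕ} (his : i < s) (him : Nat.gcd i s = 1)
    (hh : 2 * h = 2 ^ s - 2 ^ i) {F K : Type*} [Field F] [Field K] [Fintype F] [Algebra F K]
    [CharP K 2] (hF : Fintype.card F = 2 ^ s) {β : K} (hβ : IsPrimitiveRoot β (2 ^ s + 1)) :
    InGeneralPosition F 4
      fun j : Fin (2 ^ s + 1) => (β ^ (h * (j : ℕ)), β ^ ((h + 1) * (j : ℕ))) := by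
  have : Fact (Nat.Prime 2) := ⟨Nat.prime_two⟩
  intro S hS
  let e := (S.equivFinOfCardEq hS).symm
  refine (linearIndependent_equiv e).1 (Fintype.linearIndependent_iff.2 fun c hc => ?_)
  let u : Fin 4 → K := fun k => β ^ ((e k : Fin (2 ^ s + 1)) : ℕ)
  have hu : ∀ k, u k ^ (2 ^ s + 1) = 1 := fun k => by
    simp only [u]
    rw [← pow_mul, mul_comm, pow_mul, hβ.pow_eq_one, one_pow]
  have hinj : Function.Injective u := fun a b hab =>
    e.injective (Subtype.ext (Fin.ext (hβ.pow_inj (e a).1.2 (e b).1.2 hab)))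
  have hu0 : ∀ k, u k ≠ 0 := fun k h0 => by simpa [h0] using hu k
  have hle : 2 ^ i ≤ 2 ^ s := Nat.pow_le_pow_right two_pos his.le
  have hc1 : ∑ k, algebraMap F K (c k) * u k ^ h = 0 := by
    simpa [Prod.fst_sum, Algebra.smul_def, u, ← pow_mul, mul_comm h] using congrArg Prod.fst hc
  have hc2 : ∑ k, algebraMap F K (c k) * u k ^ (h + 1) = 0 := by
    simpa [Prod.snd_sum, Algebra.smul_def, u, ← pow_mul, mul_comm (h + 1)]
      using congrArg Prod.snd hc
  have hconj : ∀ m : ℕ, ∑ k, algebraMap F K (c k) * u k ^ m = 0 →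
      ∑ k, algebraMap F K (c k) * u k ^ (m * 2 ^ s) = 0 := fun m hm => by
    have := congrArg (· ^ 2 ^ s) hm
    simp only [sum_pow_char_pow, mul_pow, ← map_pow, ← pow_mul] at this
    simpa [← hF, FiniteField.pow_card] using this
  have hc3 : ∑ k, algebraMap F K (c k) * u k ^ (h + 1 + 2 ^ i) = 0 := by
    rw [← hconj h hc1]
    refine Finset.sum_congr rfl fun k _ => ?_
    congr 1
    apply mul_right_cancel₀ (pow_ne_zero h (hu0 k))
    rw [← pow_add, ← pow_add, show h * 2 ^ s + h = (2 ^ s + 1) * h by ring, pow_mul, hu, one_pow,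
      show h + 1 + 2 ^ i + h = 2 ^ s + 1 by omega, hu]
  have hc4 : ∑ k, algebraMap F K (c k) * u k ^ (h + 2 ^ i) = 0 := by
    rw [← hconj (h + 1) hc2]
    refine Finset.sum_congr rfl fun k _ => ?_
    congr 1
    apply mul_right_cancel₀ (pow_ne_zero (h + 1) (hu0 k))
    rw [← pow_add, ← pow_add,
      show (h + 1) * 2 ^ s + (h + 1) = (2 ^ s + 1) * (h + 1) by ring, pow_mul, hu, one_pow,
      show h + 2 ^ i + (h + 1) = 2 ^ s + 1 by omega, hu]
  have hvec : (fun k => algebraMap F K (c k) * u k ^ h) = 0 := by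
    refine Matrix.eq_zero_of_vecMul_eq_zero (det_pow_ne_zero him hinj hu) (funext fun l => ?_)
    fin_cases l
    · simpa [Matrix.vecMul, dotProduct] using hc1
    · simpa [Matrix.vecMul, dotProduct, pow_succ, mul_assoc] using hc2
    · simpa [Matrix.vecMul, dotProduct, pow_add, mul_assoc] using hc4
    · simpa [Matrix.vecMul, dotProduct, pow_add, mul_assoc] using hc3
  intro k
  have := congrFun hvec k
  simpa [hu0 k] using this

/-- Every `F`-linear functional on `K × K` is a sum of two trace functionals. -/
theorem exists_dual_prod_iff_exists_trace {ι F K : Type*} [Field F] [Field K] [Algebra F K]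
    [FiniteDimensional F K] [Algebra.IsSeparable F K] (x y : ι → K) (c : ι → F) :
    (∃ φ : Module.Dual F (K × K), ∀ j, c j = φ (x j, y j)) ↔
      ∃ a b : K, ∀ j, c j = Algebra.trace F K (a * x j + b * y j) := by
  have hsurj := ((Algebra.traceForm F K).toDual (traceForm_nondegenerate F K)).surjective
  constructor
  · rintro ⟨φ, hφ⟩
    obtain ⟨a, ha⟩ := hsurj (φ ∘ₗ LinearMap.inl F K K)
    obtain ⟨b, hb⟩ := hsurj (φ ∘ₗ LinearMap.inr F K K)
    refine ⟨a, b, fun j => ?_⟩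
    have hx := LinearMap.congr_fun ha (x j)
    have hy := LinearMap.congr_fun hb (y j)
    simp only [LinearMap.BilinForm.toDual_def, Algebra.traceForm_apply, LinearMap.comp_apply,
      LinearMap.inl_apply, LinearMap.inr_apply] at hx hy
    rw [hφ, map_add, hx, hy, ← map_add]
    simp
  · rintro ⟨a, b, hab⟩
    refine ⟨(Algebra.traceForm F K a).coprod (Algebra.traceForm F K b), fun j => ?_⟩
    simp [hab, Algebra.traceForm_apply]


theorem stmt3 (s : ℕ) (hs : 1 < s) (q : ℕ) (hq : q = 2 ^ s)
    (i : ℕ) (hi0 : 0 < i) (his : i < s) (him : Nat.gcd i s = 1)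
    (h : ℕ) (hh : 2 * h = q - 2 ^ i)
    (F K : Type) [Field F] [Field K] [Fintype F] [Fintype K] [DecidableEq F]
    [Algebra F K] (hF : Fintype.card F = q) (hK : Fintype.card K = q ^ 2)
    (β : K) (hβ : IsPrimitiveRoot β (q + 1))
    (C : Set (Fin (q + 1) → F))
    (hC : C = {c | (∑ j : Fin (q + 1), algebraMap F K (c j) * β ^ (h * (j : ℕ)) = 0) ∧
      (∑ j : Fin (q + 1), algebraMap F K (c j) * β ^ ((h + 1) * (j : ℕ)) = 0)})
    (D : Set (Fin (q + 1) → F))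
    (hD : D = {c | ∃ a b : K, ∀ j : Fin (q + 1),
      c j = Algebra.trace F K (a * β ^ (h * (j : ℕ)) + b * β ^ ((h + 1) * (j : ℕ)))}) :
    C.ncard = q ^ (q - 3) ∧
    IsLeast {w : ℕ | ∃ c ∈ C, c ≠ 0 ∧ hammingNorm c = w} 5 ∧
    D.ncard = q ^ 4 ∧
    IsLeast {w : ℕ | ∃ c ∈ D, c ≠ 0 ∧ hammingNorm c = w} (q - 2) := by

  subst hq
  have : Fact (Nat.Prime 2) := ⟨Nat.prime_two⟩
  have : CharP K 2 := charP_of_card_eq_prime_pow (hK.trans (pow_mul 2 s 2).symm)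
  have hq4 : 4 ≤ 2 ^ s := by
    simpa using Nat.pow_le_pow_right (n := 2) two_pos (show 2 ≤ s from hs)
  have hrank : Module.finrank F K = 2 := by
    have := Module.card_eq_pow_finrank (K := F) (V := K)
    rw [hF, hK] at this
    exact (Nat.pow_right_injective (show 2 ≤ 2 ^ s by omega) this).symm
  have hV : Module.finrank F (K × K) = 4 := by rw [Module.finrank_prod, hrank]
  have hg := inGeneralPosition_zeros his him hh hF hβ
  have hC' : C = {c | ∑ j : Fin (2 ^ s + 1),
      c j • (β ^ (h * (j : ℕ)), β ^ ((h + 1) * (j : ℕ))) = 0} := by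
    rw [hC]
    ext c
    simp [Prod.ext_iff, Prod.fst_sum, Prod.snd_sum, Algebra.smul_def]
  have hD' : D = {c | ∃ φ : Module.Dual F (K × K), ∀ j : Fin (2 ^ s + 1),
      c j = φ (β ^ (h * (j : ℕ)), β ^ ((h + 1) * (j : ℕ)))} := by
    rw [hD]
    ext c
    exact (exists_dual_prod_iff_exists_trace _ _ c).symm
  have hcard : Fintype.card (Fin (2 ^ s + 1)) = 2 ^ s + 1 := Fintype.card_fin _
  have hmin := hg.isLeast_hammingNorm_dual hV (by norm_num) (by omega)
  rw [hcard, show 2 ^ s + 1 - 4 + 1 = 2 ^ s - 2 by omega] at hmin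
  rw [hC', hD']
  refine ⟨?_, hg.isLeast_hammingNorm_ker hV (by omega), ?_, hmin⟩
  · rw [hg.ncard_ker hV (by omega), hF, hcard]
    congr 1
  · rw [hg.ncard_dual hV (by omega), hF]
end

section
/- Let q = p^s with p an odd prime and s > 1, let 0 < i < s with m = gcd(i, s), and set h = (p^i − 1)/2. Then D_h contains exactly q^4 codewords (so it has dimension 4 over F_q), the set of Hamming weights of its nonzero codewords is exactly {q − p^m, q − 1, q, q + 1}, and in particular D_h is a four-weight code with parameters [q + 1, 4, q − p^m]. -/
/-- In a finite field, the equation `t ^ (d + 1) = t` has `d + 1` solutions when `d` divides the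
order of the unit group. -/
theorem card_zero_or_pow_eq_one {K : Type*} [Field K] [Fintype K] [DecidableEq K] {d : ℕ}
    (hd0 : 0 < d) (hd : d ∣ Fintype.card K - 1) :
    (Finset.univ.filter fun t : K => t = 0 ∨ t ^ d = 1).card = d + 1 := by
  obtain ⟨e, he⟩ := hd
  obtain ⟨g, hg⟩ := IsCyclic.exists_ofOrder_eq_natCard (α := Kˣ)
  rw [Nat.card_eq_fintype_card, Fintype.card_units] at hg
  have hprim : IsPrimitiveRoot (g : K) (Fintype.card K - 1) :=
    IsPrimitiveRoot.coe_units_iff.2 (hg ▸ IsPrimitiveRoot.orderOf g)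
  have hζ : IsPrimitiveRoot ((g : K) ^ e) d :=
    hprim.pow (by have := Fintype.one_lt_card (α := K); omega) (by rw [he, mul_comm])
  have : (Finset.univ.filter fun t : K => t = 0 ∨ t ^ d = 1) =
      insert 0 (Polynomial.nthRootsFinset d (1 : K)) := by
    ext t
    simp [Polynomial.mem_nthRootsFinset hd0]
  rw [this, Finset.card_insert_of_notMem, hζ.card_nthRootsFinset]
  simp [Polynomial.mem_nthRootsFinset hd0, hd0.ne']

theorem pow_eq_self_iff_eq_zero_or {K : Type*} [Field K] {n : ℕ} (hn : 1 < n) (t : K) :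
    t ^ n = t ↔ t = 0 ∨ t ^ (n - 1) = 1 := by
  obtain ⟨k, rfl⟩ : ∃ k, n = k + 1 := ⟨n - 1, by omega⟩
  rcases eq_or_ne t 0 with rfl | ht
  · simp
  · simp [pow_succ, ht]

theorem pow_eq_self_and_pow_eq_self_iff {K : Type*} [Field K] {p i s : ℕ} (hp : 1 < p)
    (hi : i ≠ 0) (hs : s ≠ 0) (t : K) :
    (t ^ p ^ s = t ∧ t ^ p ^ i = t) ↔ t = 0 ∨ t ^ (p ^ i.gcd s - 1) = 1 := by
  rw [pow_eq_self_iff_eq_zero_or (Nat.one_lt_pow hs hp),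
    pow_eq_self_iff_eq_zero_or (Nat.one_lt_pow hi hp), ← Nat.pow_sub_one_gcd_pow_sub_one,
    pow_gcd_eq_one]
  tauto

/-- The cross-ratio of four points of the unit circle `{x | x ^ (q + 1) = 1}` is fixed by the
`q`-power Frobenius. -/
theorem cross_ratio_pow_eq_self {K : Type*} [Field K] {p s : ℕ} [Fact p.Prime] [CharP K p]
    {x u v w : K} (hx : x ^ (p ^ s + 1) = 1) (hu : u ^ (p ^ s + 1) = 1)
    (hv : v ^ (p ^ s + 1) = 1) (hw : w ^ (p ^ s + 1) = 1) (hxw : x ≠ w) (huv : v ≠ u) :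
    ((x - u) * (v - w) / ((x - w) * (v - u))) ^ p ^ s =
      (x - u) * (v - w) / ((x - w) * (v - u)) := by
  have ne {y : K} (hy : y ^ (p ^ s + 1) = 1) : y ≠ 0 := by rintro rfl; simp at hy
  have inv {y : K} (hy : y ^ (p ^ s + 1) = 1) : y ^ p ^ s = y⁻¹ := by
    exact eq_inv_of_mul_eq_one_left (by rw [← pow_succ, hy])
  have h1 {y z : K} (hy : y ≠ 0) (hz : z ≠ 0) : y⁻¹ - z⁻¹ = -(y - z) * (y⁻¹ * z⁻¹) := by
    field_simp; ring
  have hx0 := ne hx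
  have hu0 := ne hu
  have hv0 := ne hv
  have hw0 := ne hw
  have h2 : x - w ≠ 0 := sub_ne_zero.2 hxw
  have h3 : v - u ≠ 0 := sub_ne_zero.2 huv
  simp only [div_pow, mul_pow, sub_pow_char_pow, inv hx, inv hu, inv hv, inv hw]
  rw [h1 hx0 hu0, h1 hx0 hw0, h1 hv0 hu0, h1 hv0 hw0]
  field_simp

theorem cross_ratio_injOn {K : Type*} [Field K] {x y u v w : K} (hx : x ≠ w) (hy : y ≠ w)
    (huv : v ≠ u) (huw : u ≠ w) (hvw : v ≠ w)
    (h : (x - u) * (v - w) / ((x - w) * (v - u)) = (y - u) * (v - w) / ((y - w) * (v - u))) :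
    x = y := by
  have h1 := sub_ne_zero.2 hx
  have h2 := sub_ne_zero.2 hy
  have h3 := sub_ne_zero.2 huv
  have h4 := sub_ne_zero.2 huw
  have h5 := sub_ne_zero.2 hvw
  rw [div_eq_div_iff (mul_ne_zero h1 h3) (mul_ne_zero h2 h3)] at h
  have : (x - y) * ((u - w) * (v - w) * (v - u)) = 0 := by linear_combination h
  rcases mul_eq_zero.1 this with h | h
  · exact sub_eq_zero.1 h
  · simp_all

/-- A nonzero polynomial of the shape `b X ^ (Q + 1) + a X ^ Q + c X + d`, with `Q` a power of the
characteristic, vanishing at three points vanishes exactly where the cross-ratio with those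
points lies in the field of `Q` elements. -/
theorem eval_eq_zero_iff_cross_ratio {K : Type*} [Field K] {p i : ℕ} [Fact p.Prime] [CharP K p]
    {a b c d u v w x y : K}
    (hu : b * u ^ (p ^ i + 1) + a * u ^ p ^ i + c * u + d = 0)
    (hv : b * v ^ (p ^ i + 1) + a * v ^ p ^ i + c * v + d = 0)
    (hw : b * w ^ (p ^ i + 1) + a * w ^ p ^ i + c * w + d = 0)
    (hy : b * y ^ (p ^ i + 1) + a * y ^ p ^ i + c * y + d ≠ 0)
    (huv : v ≠ u) (huw : u ≠ w) (hvw : v ≠ w) (hx : x ≠ w) :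
    b * x ^ (p ^ i + 1) + a * x ^ p ^ i + c * x + d = 0 ↔
      ((x - u) * (v - w) / ((x - w) * (v - u))) ^ p ^ i =
        (x - u) * (v - w) / ((x - w) * (v - u)) := by
  set M := b * w ^ p ^ i * u + a * w ^ p ^ i + c * u + d with hM
  set N := b * u ^ p ^ i * w + a * u ^ p ^ i + c * w + d with hN
  have key (z : K) : (w - u) ^ (p ^ i + 1) * (b * z ^ (p ^ i + 1) + a * z ^ p ^ i + c * z + d) =
      -((z - u) ^ p ^ i * (z - w) * M + (z - u) * (z - w) ^ p ^ i * N) := by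
    simp only [pow_succ] at hu hw ⊢
    simp only [sub_pow_char_pow, hM, hN]
    linear_combination (z ^ p ^ i - u ^ p ^ i) * (z - u) * hw +
      (z ^ p ^ i - w ^ p ^ i) * (z - w) * hu
  have hxw := sub_ne_zero.2 hx
  have hvu := sub_ne_zero.2 huv
  have hwu := sub_ne_zero.2 huw.symm
  have hvw' := sub_ne_zero.2 hvw
  have h1 := key v
  rw [hv, mul_zero, eq_comm, neg_eq_zero] at h1
  have hMne : M ≠ 0 := by
    intro hM0
    have hN0 : N = 0 := by simpa [hM0, hvu, hvw'] using h1
    have := key y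
    rw [hM0, hN0] at this
    simp [hwu, hy] at this
  have : b * x ^ (p ^ i + 1) + a * x ^ p ^ i + c * x + d = 0 ↔
      (x - u) ^ p ^ i * (x - w) * M + (x - u) * (x - w) ^ p ^ i * N = 0 := by
    rw [← neg_eq_zero (a := _ + _ * N), ← key x]
    simp [hwu]
  rw [this, div_pow, div_eq_div_iff (pow_ne_zero _ (mul_ne_zero hxw hvu)) (mul_ne_zero hxw hvu),
    mul_pow, mul_pow]
  constructor <;> intro h
  · refine mul_left_cancel₀ hMne ?_
    linear_combination (v - u) * (v - w) ^ p ^ i * h - (x - u) * (x - w) ^ p ^ i * h1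
  · refine mul_left_cancel₀ (mul_ne_zero hvu (pow_ne_zero (p ^ i) hvw')) ?_
    linear_combination M * h + (x - u) * (x - w) ^ p ^ i * h1

/-- A nonzero polynomial of the shape `b X ^ (p ^ i + 1) + a X ^ (p ^ i) + c X + d` with at least
three zeros on the unit circle `{x | x ^ (p ^ s + 1) = 1}` has exactly `p ^ gcd(i, s) + 1`. -/
theorem card_zeros_eq_of_three_zeros {K : Type*} [Field K] [Fintype K] [DecidableEq K]
    {p i s : ℕ} [Fact p.Prime] [CharP K p] (hi : i ≠ 0) (hs : s ≠ 0)
    (hK : Fintype.card K = (p ^ s) ^ 2) {U : Finset K} (hUcard : U.card = p ^ s + 1)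
    (hU : ∀ x ∈ U, x ^ (p ^ s + 1) = 1) {f : K → K} {a b c d : K}
    (hf : ∀ x, f x = b * x ^ (p ^ i + 1) + a * x ^ p ^ i + c * x + d)
    {u v w y : K} (hu : u ∈ U) (hv : v ∈ U) (hw : w ∈ U)
    (hfu : f u = 0) (hfv : f v = 0) (hfw : f w = 0) (hfy : f y ≠ 0)
    (huv : v ≠ u) (huw : u ≠ w) (hvw : v ≠ w) :
    (U.filter fun x => f x = 0).card = p ^ i.gcd s + 1 := by
  have hp1 : 1 < p := (Fact.out : p.Prime).one_lt
  set t : K → K := fun x => (x - u) * (v - w) / ((x - w) * (v - u)) with ht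
  have hcard (m : ℕ) (hm : m ≠ 0) (hms : m ∣ s) :
      (Finset.univ.filter fun t : K => t = 0 ∨ t ^ (p ^ m - 1) = 1).card = p ^ m := by
    have h1 : 1 < p ^ m := Nat.one_lt_pow hm hp1
    rw [card_zero_or_pow_eq_one (by omega), Nat.sub_add_cancel h1.le]
    rw [hK, ← pow_mul]
    exact Nat.pow_sub_one_dvd_pow_sub_one p (hms.mul_right 2)
  have hinj : Set.InjOn t (U.erase w) := by
    intro x hx y hy h
    simp only [Finset.coe_erase, Set.mem_sdiff, Finset.mem_coe, Set.mem_singleton_iff] at hx hy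
    exact cross_ratio_injOn hx.2 hy.2 huv huw hvw h
  have himage : (U.erase w).image t = Finset.univ.filter fun t : K => t ^ p ^ s = t := by
    refine Finset.eq_of_subset_of_card_le ?_ ?_
    · intro z hz
      obtain ⟨x, hx, rfl⟩ := Finset.mem_image.1 hz
      rw [Finset.mem_erase] at hx
      simpa using cross_ratio_pow_eq_self (hU x hx.2) (hU u hu) (hU v hv) (hU w hw) hx.1 huv
    · rw [Finset.card_image_of_injOn hinj, Finset.card_erase_of_mem hw, hUcard]
      simp only [pow_eq_self_iff_eq_zero_or (Nat.one_lt_pow hs hp1)]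
      rw [hcard s hs dvd_rfl, Nat.add_sub_cancel]
  have hsplit : U.filter (fun x => f x = 0) =
      insert w ((U.erase w).filter fun x => t x ^ p ^ i = t x) := by
    ext x
    rcases eq_or_ne x w with rfl | hx
    · simp [hw, hfw]
    · have := eval_eq_zero_iff_cross_ratio (hf u ▸ hfu) (hf v ▸ hfv) (hf w ▸ hfw) (hf y ▸ hfy)
        huv huw hvw hx
      simp [hx, hf, this, ht]
  rw [hsplit, Finset.card_insert_of_notMem (by simp),
    ← Finset.card_image_of_injOn (hinj.mono (Finset.coe_subset.2 (Finset.filter_subset _ _))),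
    ← Finset.filter_image (p := fun z : K => z ^ p ^ i = z), himage, Finset.filter_filter]
  simp only [pow_eq_self_and_pow_eq_self_iff hp1 hi hs]
  rw [hcard _ (Nat.gcd_pos_of_pos_left _ (Nat.pos_of_ne_zero hi)).ne' (Nat.gcd_dvd_right i s)]

theorem exists_eval_ne_zero_of_lt_card {K : Type*} [Field K] {Q : ℕ} (hQ : 1 < Q) {U : Finset K}
    (hU : Q + 1 < U.card) {a b : K} (hab : ¬(a = 0 ∧ b = 0)) (c d : K) :
    ∃ y ∈ U, b * y ^ (Q + 1) + a * y ^ Q + c * y + d ≠ 0 := by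
  open Polynomial in
  by_contra! hall
  set P : K[X] := C b * X ^ (Q + 1) + C a * X ^ Q + C c * X + C d with hP
  have hdeg : P.natDegree ≤ Q + 1 := by
    rw [hP]
    compute_degree
  have h0 : P = 0 :=
    eq_zero_of_natDegree_lt_card_of_eval_eq_zero' P U (fun y hy => by simpa [hP] using hall y hy)
      (by omega)
  have h1 : Q ≠ 0 := by omega
  have h2 : Q ≠ 1 := by omega
  refine hab ⟨?_, ?_⟩
  · simpa [hP, coeff_X, coeff_C, h1, h2, h2.symm] using congrArg (fun r => r.coeff Q) h0
  · simpa [hP, coeff_X, coeff_C, h1] using congrArg (fun r => r.coeff (Q + 1)) h0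

/-- For `Q = 2 h + 1`, the trace of `a x ^ h + b x ^ (h + 1)` at a point `x` of the unit circle
vanishes exactly when a self-reciprocal polynomial of degree `Q + 1` does. -/
theorem trace_eq_zero_iff {F K : Type*} [Field F] [Field K] [Fintype F] [Fintype K] [Algebra F K]
    {p s : ℕ} [Fact p.Prime] [CharP K p] (hF : Fintype.card F = p ^ s)
    (hK : Fintype.card K = (p ^ s) ^ 2) (h : ℕ) (a b : K) {x : K} (hx : x ^ (p ^ s + 1) = 1) :
    Algebra.trace F K (a * x ^ h + b * x ^ (h + 1)) = 0 ↔
      b * x ^ (2 * h + 1 + 1) + a * x ^ (2 * h + 1) + a ^ p ^ s * x + b ^ p ^ s = 0 := by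
  have hx0 : x ≠ 0 := by rintro rfl; simp at hx
  have hfin : Module.finrank F K = 2 := by
    have := Module.card_eq_pow_finrank (K := F) (V := K)
    rw [hK, hF] at this
    refine (Nat.pow_right_injective (a := p ^ s) ?_ this).symm
    exact hF ▸ Fintype.one_lt_card
  rw [← map_eq_zero (algebraMap F K), FiniteField.algebraMap_trace_eq_sum_pow, hfin,
    Finset.sum_range_succ, Finset.sum_range_one, Nat.card_eq_fintype_card, hF, pow_zero, pow_one,
    pow_one, add_pow_char_pow, mul_pow, mul_pow,
    ← mul_eq_zero_iff_right (pow_ne_zero (h + 1) hx0)]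
  have h1 : (x ^ h) ^ p ^ s * x ^ (h + 1) = x := by
    rw [pow_succ, ← mul_assoc, ← pow_mul, ← pow_add, ← Nat.mul_succ, mul_comm, Nat.succ_eq_add_one,
      mul_comm h, pow_mul, hx, one_pow, mul_one]
  have h2 : (x ^ (h + 1)) ^ p ^ s * x ^ (h + 1) = 1 := by
    rw [← pow_succ, ← pow_mul, mul_comm, pow_mul, hx, one_pow]
  rw [← eq_iff_iff]
  congr 1
  linear_combination (a ^ p ^ s) * h1 + b ^ p ^ s * h2

/-- The encoder `(a, b) ↦ (Tr (a β ^ (h j) + b β ^ ((h + 1) j)))_j`. -/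
noncomputable def traceEncoder (F : Type*) {K : Type*} [Field F] [Field K] [Algebra F K]
    (β : K) (h n : ℕ) : K × K →ₗ[F] (Fin n → F) :=
  LinearMap.pi fun j => Algebra.trace F K ∘ₗ
    (LinearMap.mulRight F (β ^ (h * (j : ℕ)))).coprod
      (LinearMap.mulRight F (β ^ ((h + 1) * (j : ℕ))))

theorem traceEncoder_apply (F : Type*) {K : Type*} [Field F] [Field K] [Algebra F K]
    (β : K) (h n : ℕ) (a b : K) (j : Fin n) :
    traceEncoder F β h n (a, b) j =
      Algebra.trace F K (a * β ^ (h * (j : ℕ)) + b * β ^ ((h + 1) * (j : ℕ))) := rfl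

theorem exists_card_zeros_eq_zero {K : Type*} [Field K] [Fintype K] {p s : ℕ} [Fact p.Prime]
    [CharP K p] (hpodd : Odd p) (hK : Fintype.card K = (p ^ s) ^ 2) {β : K}
    (hβ : IsPrimitiveRoot β (p ^ s + 1)) (h : ℕ) :
    ∃ a b : K, ∀ x : K, x ^ (p ^ s + 1) = 1 →
      b * x ^ (2 * h + 1 + 1) + a * x ^ (2 * h + 1) + a ^ p ^ s * x + b ^ p ^ s ≠ 0 := by
  have hp0 : 0 < p ^ s := pow_pos (Fact.out : p.Prime).pos s
  obtain ⟨r, hr⟩ : Even (p ^ s + 1) := (hpodd.pow).add_one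
  refine ⟨1 - β ^ p ^ s, 0, fun x hx hzero => ?_⟩
  have hβ1 := hβ.pow_eq_one
  have ha : (1 - β ^ p ^ s) ^ p ^ s = 1 - β := by
    rw [sub_pow_char_pow, one_pow, ← pow_mul, ← sq, ← hK, FiniteField.pow_card]
  have hx0 : x ≠ 0 := by rintro rfl; simp at hx
  have hne : β - 1 ≠ 0 := sub_ne_zero.2 (hβ.ne_one (by omega))
  have h1 : x ^ (2 * h) = β := by
    rw [ha, zero_pow hp0.ne'] at hzero
    rw [pow_succ] at hzero hβ1
    refine mul_left_cancel₀ (mul_ne_zero hne hx0) ?_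
    linear_combination β * hzero + x * x ^ (2 * h) * hβ1
  have h2 : β ^ r = 1 := by
    rw [← h1, ← pow_mul, show 2 * h * r = (p ^ s + 1) * h by rw [hr]; ring, pow_mul, hx, one_pow]
  exact hβ.pow_ne_one_of_pos_of_lt (by omega) (by omega) h2

theorem exists_zeros_eq_one {K : Type*} [Field K] {p s i : ℕ} [Fact p.Prime]
    [CharP K p] (hpodd : Odd p) :
    ∃ a b : K, ∀ x : K,
      b * x ^ (p ^ i + 1) + a * x ^ p ^ i + a ^ p ^ s * x + b ^ p ^ s = 0 ↔ x = 1 := by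
  refine ⟨-1, 1, fun x => ?_⟩
  rw [(hpodd.pow).neg_one_pow, one_pow]
  have : 1 * x ^ (p ^ i + 1) + -1 * x ^ p ^ i + -1 * x + 1 = (x - 1) ^ (p ^ i + 1) := by
    rw [pow_succ (x - 1), sub_pow_char_pow, one_pow]; ring
  rw [this, pow_eq_zero_iff (Nat.succ_ne_zero _), sub_eq_zero]

theorem exists_zeros_eq_pair {K : Type*} [Field K] [Fintype K] {p s i : ℕ} [Fact p.Prime]
    [CharP K p] (hpodd : Odd p) (hs : s ≠ 0) (hK : Fintype.card K = (p ^ s) ^ 2) {β : K}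
    (hβ : IsPrimitiveRoot β (p ^ s + 1)) :
    ∃ a b : K, ∀ x : K,
      b * x ^ (p ^ i + 1) + a * x ^ p ^ i + a ^ p ^ s * x + b ^ p ^ s = 0 ↔ x = 1 ∨ x = β := by
  have h1 : 1 < p ^ s := Nat.one_lt_pow hs (Fact.out : p.Prime).one_lt
  have hβ1 := hβ.pow_eq_one
  rw [pow_succ] at hβ1
  have hb : (1 + β ^ p ^ s) ^ p ^ s = 1 + β := by
    rw [add_pow_char_pow, one_pow, ← pow_mul, ← sq, ← hK, FiniteField.pow_card]
  have hne : 1 + β ^ p ^ s ≠ 0 := by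
    intro h0
    rw [h0, zero_pow (by omega)] at hb
    have : β ^ 2 = 1 := by linear_combination -(β - 1) * hb
    exact hβ.pow_ne_one_of_pos_of_lt two_ne_zero (by omega) this
  refine ⟨-(1 + β), 1 + β ^ p ^ s, fun x => ?_⟩
  rw [(hpodd.pow).neg_pow, hb, add_pow_char_pow, one_pow]
  have : (1 + β ^ p ^ s) * x ^ (p ^ i + 1) + -(1 + β) * x ^ p ^ i + -(1 + β ^ p ^ s) * x +
      (1 + β) = (1 + β ^ p ^ s) * ((x - 1) ^ p ^ i * (x - β)) := by
    rw [sub_pow_char_pow, one_pow]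
    linear_combination (1 - x ^ p ^ i) * -hβ1
  rw [this, mul_eq_zero, mul_eq_zero, pow_eq_zero_iff (pow_ne_zero _ (Fact.out : p.Prime).ne_zero),
    sub_eq_zero, sub_eq_zero]
  simp [hne]

theorem stmt5 (p s : ℕ) (hp : p.Prime) (hpodd : Odd p) (hs : 1 < s)
    (q : ℕ) (hq : q = p ^ s)
    (i m : ℕ) (hi0 : 0 < i) (his : i < s) (hm : m = Nat.gcd i s)
    (h : ℕ) (hh : 2 * h = p ^ i - 1)
    (F K : Type) [Field F] [Field K] [Fintype F] [Fintype K] [DecidableEq F]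
    [Algebra F K] (hF : Fintype.card F = q) (hK : Fintype.card K = q ^ 2)
    (β : K) (hβ : IsPrimitiveRoot β (q + 1))
    (D : Set (Fin (q + 1) → F))
    (hD : D = {c | ∃ a b : K, ∀ j : Fin (q + 1),
      c j = Algebra.trace F K (a * β ^ (h * (j : ℕ)) + b * β ^ ((h + 1) * (j : ℕ)))}) :
    D.ncard = q ^ 4 ∧
    {w : ℕ | ∃ c ∈ D, c ≠ 0 ∧ hammingNorm c = w} =
      {q - p ^ m, q - 1, q, q + 1} := by
  classical
  subst hq hm
  have : Fact p.Prime := ⟨hp⟩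
  have : CharP K p := charP_of_card_eq_prime_pow (hK.trans (pow_mul p s 2).symm)
  have hp3 : 3 ≤ p := by
    have := hp.two_le
    obtain ⟨k, hk⟩ := hpodd
    omega
  have hQ3 : 3 ≤ p ^ i := hp3.trans (Nat.le_self_pow hi0.ne' p)
  have hQq : p ^ i < p ^ s := Nat.pow_lt_pow_right hp.one_lt his
  have hmQ : p ^ i.gcd s ≤ p ^ i := Nat.pow_le_pow_right hp.pos (Nat.gcd_le_left s hi0)
  have hm3 : 3 ≤ p ^ i.gcd s :=
    hp3.trans (Nat.le_self_pow (Nat.gcd_pos_of_pos_left s hi0).ne' p)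
  have hQ : p ^ i = 2 * h + 1 := by omega
  have h3q : 3 ≤ p ^ s + 1 := by omega
  set Φ := traceEncoder F β h (p ^ s + 1) with hΦ
  have hDΦ : D = Set.range Φ := by
    ext c
    simp only [hD, Set.mem_ofPred_eq, Set.mem_range, Prod.exists, funext_iff, hΦ,
      traceEncoder_apply, eq_comm]
  set f : K → K → K → K := fun a b x =>
    b * x ^ (p ^ i + 1) + a * x ^ p ^ i + a ^ p ^ s * x + b ^ p ^ s with hf
  set g : Fin (p ^ s + 1) → K := fun j => β ^ (j : ℕ) with hg
  have hginj : Function.Injective g := fun j k hjk => Fin.ext (hβ.pow_inj j.2 k.2 hjk)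
  set U : Finset K := Finset.univ.image g with hUdef
  have hUcard : U.card = p ^ s + 1 := by
    rw [hUdef, Finset.card_image_of_injective _ hginj, Finset.card_univ, Fintype.card_fin]
  have hgU (j : Fin (p ^ s + 1)) : g j ∈ U := Finset.mem_image_of_mem g (Finset.mem_univ j)
  have hg1 (j : Fin (p ^ s + 1)) : g j ^ (p ^ s + 1) = 1 := by
    rw [hg, ← pow_mul, mul_comm, pow_mul, hβ.pow_eq_one, one_pow]
  have hU1 : ∀ x ∈ U, x ^ (p ^ s + 1) = 1 := by
    intro x hx
    obtain ⟨j, -, rfl⟩ := Finset.mem_image.1 hx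
    exact hg1 j
  have hΦf (a b : K) (j : Fin (p ^ s + 1)) : Φ (a, b) j = 0 ↔ f a b (g j) = 0 := by
    rw [hΦ, traceEncoder_apply, mul_comm h, mul_comm (h + 1), pow_mul, pow_mul,
      trace_eq_zero_iff hF hK h a b (hg1 j)]
    simp only [hf, hQ]
  have hne {a b : K} (hab : ¬(a = 0 ∧ b = 0)) : ∃ y ∈ U, f a b y ≠ 0 :=
    exists_eval_ne_zero_of_lt_card (by omega) (by omega) hab _ _
  have hinj : Function.Injective Φ := by
    rw [injective_iff_map_eq_zero]
    rintro ⟨a, b⟩ h0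
    by_contra hab
    obtain ⟨y, hy, hy0⟩ := hne (a := a) (b := b) (by simpa using hab)
    obtain ⟨j, -, rfl⟩ := Finset.mem_image.1 hy
    exact hy0 ((hΦf a b j).1 (congrFun h0 j))
  have hnorm (a b : K) :
      hammingNorm (Φ (a, b)) + (U.filter fun x => f a b x = 0).card = p ^ s + 1 := by
    have : (U.filter fun x => f a b x = 0).card =
        (Finset.univ.filter fun j => Φ (a, b) j = 0).card := by
      rw [hUdef, Finset.filter_image, Finset.card_image_of_injective _ hginj]
      simp only [hΦf]
    rw [this, hammingNorm, add_comm]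
    simpa using Finset.card_filter_add_card_filter_not (s := Finset.univ)
      (fun j => Φ (a, b) j = 0)
  have hthree {a b : K} (hab : ¬(a = 0 ∧ b = 0))
      (h2 : 2 < (U.filter fun x => f a b x = 0).card) :
      (U.filter fun x => f a b x = 0).card = p ^ i.gcd s + 1 := by
    obtain ⟨u, hu, v, hv, w, hw, huv, huw, hvw⟩ := Finset.two_lt_card.1 h2
    obtain ⟨y, -, hy⟩ := hne hab
    rw [Finset.mem_filter] at hu hv hw
    exact card_zeros_eq_of_three_zeros hi0.ne' (by omega) hK hUcard hU1 (fun x => rfl)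
      hu.1 hv.1 hw.1 hu.2 hv.2 hw.2 hy huv.symm huw hvw
  have hmem (a b : K) {w : ℕ} (hw : w ≠ 0)
      (hc : w + (U.filter fun x => f a b x = 0).card = p ^ s + 1) :
      ∃ c ∈ D, c ≠ 0 ∧ hammingNorm c = w := by
    have := hnorm a b
    have hnw : hammingNorm (Φ (a, b)) = w := by omega
    exact ⟨Φ (a, b), hDΦ ▸ ⟨_, rfl⟩, hammingNorm_ne_zero_iff.1 (hnw ▸ hw), hnw⟩
  have h1U : (1 : K) ∈ U := by simpa [hg] using hgU 0
  have hβU : β ∈ U := by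
    have := hgU ⟨1, by omega⟩
    simpa [hg] using this
  constructor
  · rw [hDΦ, ← Set.image_univ, Set.ncard_image_of_injective _ hinj, Set.ncard_univ,
      Nat.card_eq_fintype_card, Fintype.card_prod, hK]
    ring
  · ext w
    simp only [Set.mem_ofPred_eq, Set.mem_insert_iff, Set.mem_singleton_iff]
    constructor
    · rintro ⟨c, hc, hc0, rfl⟩
      rw [hDΦ] at hc
      obtain ⟨⟨a, b⟩, rfl⟩ := hc
      have hab : ¬(a = 0 ∧ b = 0) := by
        rintro ⟨rfl, rfl⟩
        exact hc0 (map_zero Φ)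
      have h1 := hnorm a b
      have h2 := hthree hab
      omega
    · rintro (rfl | rfl | rfl | rfl)
      · obtain ⟨⟨a, b⟩, hker, hab⟩ := Submodule.exists_mem_ne_zero_of_ne_bot
          (LinearMap.ker_ne_bot_of_finrank_lt
            (f := LinearMap.funLeft F F (Fin.castLE h3q) ∘ₗ Φ) (by
              have := Module.card_eq_pow_finrank (K := F) (V := K × K)
              rw [Fintype.card_prod, hK, hF, ← pow_add] at this
              have := Nat.pow_right_injective (a := p ^ s) (by omega) this
              rw [← this]
              simp))
        have hzero (k : Fin 3) : f a b (g (Fin.castLE h3q k)) = 0 :=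
          (hΦf a b _).1 (congrFun (LinearMap.mem_ker.1 hker) k)
        refine hmem a b (by omega) ?_
        rw [hthree (by simpa using hab)]
        · omega
        · have hsub : (Finset.univ.image fun k : Fin 3 =>
              g (Fin.castLE h3q k)) ⊆ U.filter fun x => f a b x = 0 := by
            intro x hx
            obtain ⟨k, -, rfl⟩ := Finset.mem_image.1 hx
            exact Finset.mem_filter.2 ⟨hgU _, hzero k⟩
          have := Finset.card_le_card hsub
          rw [Finset.card_image_of_injective _ (f := fun k : Fin 3 => g (Fin.castLE h3q k))
            (hginj.comp (Fin.castLE_injective h3q))] at this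
          simpa [Nat.succ_le_iff] using this
      · obtain ⟨a, b, hz⟩ := exists_zeros_eq_pair (i := i) hpodd (by omega) hK hβ
        refine hmem a b (by omega) ?_
        have : (U.filter fun x => f a b x = 0) = {1, β} := by
          ext x
          simp only [hf, hz, Finset.mem_filter, Finset.mem_insert, Finset.mem_singleton]
          constructor
          · exact fun hx => hx.2
          · rintro (hx | hx)
            · exact ⟨hx ▸ h1U, .inl hx⟩
            · exact ⟨hx ▸ hβU, .inr hx⟩
        rw [this, Finset.card_pair (hβ.ne_one (by omega)).symm]
        omega
      · obtain ⟨a, b, hz⟩ := exists_zeros_eq_one (K := K) (s := s) (i := i) hpodd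
        refine hmem a b (by omega) ?_
        have : (U.filter fun x => f a b x = 0) = {1} := by
          ext x
          simp only [hf, hz, Finset.mem_filter, Finset.mem_singleton]
          exact ⟨fun hx => hx.2, fun hx => ⟨hx ▸ h1U, hx⟩⟩
        rw [this, Finset.card_singleton]
      · obtain ⟨a, b, hz⟩ := exists_card_zeros_eq_zero hpodd hK hβ h
        refine hmem a b (by omega) ?_
        rw [Finset.filter_eq_empty_iff.2, Finset.card_empty]
        intro x hx
        simpa only [hf, hQ] using hz x (hU1 x hx)
end

section
/- Let q = p^s with p prime and s > 1, let 0 < i < s with m = gcd(i, s), and suppose p^m ≥ 3. Let h = (q − p^i)/2, or let p be odd and h = (p^i − 1)/2. Then the BCH code C_h is an almost MDS code with parameters [q + 1, q − 3, 4]: it contains exactly q^{q−3} codewords and its minimum distance is exactly 4. Moreover, its dual code D_h contains exactly q^4 codewords and has minimum distance q − p^m. -/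
open Finset

/-- The form `A σ(x) x + B σ(x) + C x + E` attached to a ring endomorphism `σ`. -/
def twistedForm {K : Type*} [Field K] (σ : K →+* K) (A B C E x : K) : K :=
  A * (σ x * x) + B * σ x + C * x + E

section TwistedForm

variable {K : Type*} [Field K] (σ : K →+* K) {A B C E x y z w t : K}

/-- Four zeros of a nonzero twisted form have a cross-ratio fixed by `σ`. -/
theorem map_crossRatio_of_twistedForm_eq_zero
    (hne : ¬(A = 0 ∧ B = 0 ∧ C = 0 ∧ E = 0)) (hxy : x ≠ y) (hzy : z ≠ y) (hxz : x ≠ z)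
    (hxw : x ≠ w) (hx : twistedForm σ A B C E x = 0) (hy : twistedForm σ A B C E y = 0)
    (hz : twistedForm σ A B C E z = 0) (hw : twistedForm σ A B C E w = 0) :
    σ ((w - y) * (x - z) / ((x - w) * (z - y))) = (w - y) * (x - z) / ((x - w) * (z - y)) := by
  have hσ {u v : K} (h : u ≠ v) : σ u - σ v ≠ 0 := sub_ne_zero.2 (σ.injective.ne h)
  simp only [twistedForm] at hx hy hz hw
  obtain ⟨P, hP⟩ : ∃ P, P = A * (σ x * y) + B * σ x + C * y + E := ⟨_, rfl⟩
  obtain ⟨R, hR⟩ : ∃ R, R = A * (σ y * x) + B * σ y + C * x + E := ⟨_, rfl⟩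
  have ez : (σ z - σ y) * (x - z) * P + (σ x - σ z) * (z - y) * R = 0 := by
    rw [hP, hR]
    linear_combination (x - y) * (σ x - σ y) * hz - (σ z - σ y) * (z - y) * hx
      - (σ x - σ z) * (x - z) * hy
  have ew : (σ w - σ y) * (x - w) * P + (σ x - σ w) * (w - y) * R = 0 := by
    rw [hP, hR]
    linear_combination (x - y) * (σ x - σ y) * hw - (σ w - σ y) * (w - y) * hx
      - (σ x - σ w) * (x - w) * hy
  have hPR : ¬(P = 0 ∧ R = 0) := by
    rintro ⟨rfl, rfl⟩
    have hA : A = 0 := by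
      refine (mul_eq_zero.1 (?_ : A * ((σ x - σ y) * (x - y)) = 0)).resolve_right
        (mul_ne_zero (hσ hxy) (sub_ne_zero.2 hxy))
      linear_combination hx + hy + hP + hR
    have hC : C = 0 := by
      refine (mul_eq_zero.1 (?_ : C * (x - y) = 0)).resolve_right (sub_ne_zero.2 hxy)
      linear_combination hx + hP - hA * (σ x * x) + hA * (σ x * y)
    have hB : B = 0 := by
      refine (mul_eq_zero.1 (?_ : B * (σ x - σ y) = 0)).resolve_right (hσ hxy)
      linear_combination hx + hR - hA * (σ x * x) + hA * (σ y * x)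
    subst hA hB hC
    exact hne ⟨rfl, rfl, rfl, by linear_combination hx⟩
  have hR0 : R ≠ 0 := by
    rintro rfl
    refine hPR ⟨(mul_eq_zero.1 (?_ : (σ z - σ y) * (x - z) * P = 0)).resolve_left
      (mul_ne_zero (hσ hzy) (sub_ne_zero.2 hxz)), rfl⟩
    linear_combination ez
  have hP0 : P ≠ 0 := by
    rintro rfl
    refine hPR ⟨rfl, (mul_eq_zero.1 (?_ : (σ x - σ z) * (z - y) * R = 0)).resolve_left
      (mul_ne_zero (hσ hxz) (sub_ne_zero.2 hzy))⟩
    linear_combination ez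
  have key : (σ w - σ y) * (σ x - σ z) * ((x - w) * (z - y)) =
      (w - y) * (x - z) * ((σ x - σ w) * (σ z - σ y)) := by
    apply mul_right_cancel₀ (mul_ne_zero hP0 hR0)
    linear_combination (σ x - σ z) * (z - y) * R * ew - (σ x - σ w) * (w - y) * R * ez
  rw [map_div₀, div_eq_div_iff _
    (mul_ne_zero (sub_ne_zero.2 hxw) (sub_ne_zero.2 hzy))]
  · simpa only [map_mul, map_sub] using key
  · simpa only [map_mul, map_sub] using mul_ne_zero (hσ hxw) (hσ hzy)

/-- The point with prescribed cross-ratio `t` with respect to `x, y, z`; a zero of every twisted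
form vanishing at `x, y, z`, as soon as `σ t = t`. -/
theorem twistedForm_crossRatio_point (ht : σ t = t)
    (hD : t * (z - y) + (x - z) ≠ 0)
    (hx : twistedForm σ A B C E x = 0) (hy : twistedForm σ A B C E y = 0)
    (hz : twistedForm σ A B C E z = 0) :
    twistedForm σ A B C E ((t * (z - y) * x + (x - z) * y) / (t * (z - y) + (x - z))) = 0 := by
  have hD' : t * (σ z - σ y) + (σ x - σ z) ≠ 0 := by
    simpa [ht] using (map_ne_zero σ).2 hD
  simp only [twistedForm] at hx hy hz ⊢
  simp only [map_div₀, map_add, map_mul, map_sub, ht]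
  field_simp
  linear_combination t * (x - y) * (σ x - σ y) * hz
    + (t ^ 2 - t) * ((σ z - σ y) * (z - y)) * hx
    + (1 - t) * ((σ x - σ z) * (x - z)) * hy

/-- Cross-ratios of elements inverted by an endomorphism `φ` are fixed by `φ`. -/
theorem map_crossRatio_of_map_eq_inv (φ : K →+* K)
    (hx : φ x * x = 1) (hy : φ y * y = 1) (hz : φ z * z = 1) (hw : φ w * w = 1)
    (hxw : x ≠ w) (hzy : z ≠ y) :
    φ ((w - y) * (x - z) / ((x - w) * (z - y))) = (w - y) * (x - z) / ((x - w) * (z - y)) := by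
  rw [map_div₀, div_eq_div_iff _
    (mul_ne_zero (sub_ne_zero.2 hxw) (sub_ne_zero.2 hzy))]
  · simp only [map_mul, map_sub]
    have hx0 := right_ne_zero_of_mul_eq_one hx
    have hy0 := right_ne_zero_of_mul_eq_one hy
    have hz0 := right_ne_zero_of_mul_eq_one hz
    have hw0 := right_ne_zero_of_mul_eq_one hw
    rw [eq_inv_of_mul_eq_one_left hx, eq_inv_of_mul_eq_one_left hy,
      eq_inv_of_mul_eq_one_left hz, eq_inv_of_mul_eq_one_left hw]
    field_simp
    ring
  · exact (map_ne_zero φ).2 (mul_ne_zero (sub_ne_zero.2 hxw) (sub_ne_zero.2 hzy))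

theorem crossRatio_point_denom_ne_zero (φ : K →+* K)
    (hx : φ x * x = 1) (hy : φ y * y = 1) (hz : φ z * z = 1) (ht : φ t = t)
    (hxy : x ≠ y) (hxz : x ≠ z) : t * (z - y) + (x - z) ≠ 0 := by
  intro h
  have h' := congrArg φ h
  simp only [map_add, map_mul, map_sub, map_zero, ht] at h'
  have hx0 := right_ne_zero_of_mul_eq_one hx
  have hy0 := right_ne_zero_of_mul_eq_one hy
  have hz0 := right_ne_zero_of_mul_eq_one hz
  rw [eq_inv_of_mul_eq_one_left hx, eq_inv_of_mul_eq_one_left hy,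
    eq_inv_of_mul_eq_one_left hz] at h'
  field_simp at h'
  have : (x - z) * (x - y) = 0 := by
    linear_combination x * h + h'
  exact mul_ne_zero (sub_ne_zero.2 hxz) (sub_ne_zero.2 hxy) this

theorem map_crossRatio_point_mul_self (φ : K →+* K)
    (hx : φ x * x = 1) (hy : φ y * y = 1) (hz : φ z * z = 1) (ht : φ t = t)
    (hD : t * (z - y) + (x - z) ≠ 0) :
    φ ((t * (z - y) * x + (x - z) * y) / (t * (z - y) + (x - z))) *
      ((t * (z - y) * x + (x - z) * y) / (t * (z - y) + (x - z))) = 1 := by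
  have hD' := (map_ne_zero φ).2 hD
  rw [map_div₀, div_mul_div_comm, div_eq_one_iff_eq (mul_ne_zero hD' hD)]
  simp only [map_add, map_mul, map_sub, ht]
  have hx0 := right_ne_zero_of_mul_eq_one hx
  have hy0 := right_ne_zero_of_mul_eq_one hy
  have hz0 := right_ne_zero_of_mul_eq_one hz
  rw [eq_inv_of_mul_eq_one_left hx, eq_inv_of_mul_eq_one_left hy, eq_inv_of_mul_eq_one_left hz]
  field_simp
  ring

end TwistedForm

theorem pow_prime_pow_gcd_eq_self {M : Type*} [Monoid M] {p i s : ℕ} {t : M}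
    (hi : t ^ p ^ i = t) (hs : t ^ p ^ s = t) : t ^ p ^ Nat.gcd i s = t := by
  have key (n : ℕ) : Function.IsPeriodicPt (fun u : M => u ^ p) n t ↔ t ^ p ^ n = t := by
    rw [Function.IsPeriodicPt, Function.IsFixedPt, pow_iterate]
  exact (key _).1 (((key _).2 hi).gcd ((key _).2 hs))

theorem pow_prime_pow_eq_self_of_dvd {M : Type*} [Monoid M] {p m n : ℕ} {t : M}
    (h : t ^ p ^ m = t) (hd : m ∣ n) : t ^ p ^ n = t := by
  have key (n : ℕ) : Function.IsPeriodicPt (fun u : M => u ^ p) n t ↔ t ^ p ^ n = t := by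
    rw [Function.IsPeriodicPt, Function.IsFixedPt, pow_iterate]
  exact (key _).1 (((key _).2 h).trans_dvd hd)

/-- A finite field with `p ^ n` elements contains `p ^ m` solutions of `t ^ p ^ m = t`
whenever `m ∣ n`. -/
theorem exists_finset_pow_eq_self {K : Type*} [Field K] [Fintype K] {p m n : ℕ}
    (hK : Fintype.card K = p ^ n) (hd : m ∣ n) (hp : 1 < p ^ m) :
    ∃ T : Finset K, #T = p ^ m ∧ ∀ t ∈ T, t ^ p ^ m = t := by
  classical
  obtain ⟨g, hg⟩ := IsCyclic.exists_ofOrder_eq_natCard (α := Kˣ)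
  rw [Nat.card_eq_fintype_card, Fintype.card_units, hK] at hg
  have hdvd : p ^ m - 1 ∣ p ^ n - 1 := by
    obtain ⟨k, rfl⟩ := hd
    rw [pow_mul]
    simpa using Nat.sub_dvd_pow_sub_pow (p ^ m) 1 k
  obtain ⟨k, hk⟩ := hdvd
  have hn : 0 < p ^ n - 1 := by
    rw [← hK]
    have := Fintype.one_lt_card (α := K)
    omega
  have hprim : IsPrimitiveRoot (g : K) (p ^ n - 1) :=
    (hg ▸ IsPrimitiveRoot.orderOf g).map_of_injective (f := Units.coeHom K) Units.val_injective
  have hζ := hprim.pow hn (hk.trans (mul_comm _ _))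
  refine ⟨insert 0 (Polynomial.nthRootsFinset (p ^ m - 1) (1 : K)), ?_, ?_⟩
  · rw [card_insert_of_notMem, hζ.card_nthRootsFinset]
    · omega
    · rw [Polynomial.mem_nthRootsFinset (by omega), zero_pow (by omega)]
      exact zero_ne_one
  · intro t ht
    rcases mem_insert.1 ht with rfl | ht
    · exact zero_pow (by omega)
    · rw [Polynomial.mem_nthRootsFinset (by omega)] at ht
      rw [← Nat.sub_add_cancel hp.le, pow_succ, ht, one_mul]

section Counting

variable {K : Type*} [Field K] {p : ℕ} [Fact p.Prime] [CharP K p] {i s : ℕ} {A B C E : K}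

/-- A nonzero twisted form has at most `p ^ gcd i s + 1` zeros among the `(p ^ s + 1)`-st roots of
unity. -/
theorem card_zeros_twistedForm_le [DecidableEq K] (hm : 3 ≤ p ^ Nat.gcd i s)
    (hne : ¬(A = 0 ∧ B = 0 ∧ C = 0 ∧ E = 0)) (Z : Finset K) (hU : ∀ z ∈ Z, z ^ (p ^ s + 1) = 1)
    (hZ : ∀ z ∈ Z, twistedForm (iterateFrobenius K p i) A B C E z = 0) :
    #Z ≤ p ^ Nat.gcd i s + 1 := by
  by_cases h3 : #Z ≤ 2
  · omega
  obtain ⟨x, y, z, hx, hy, hz, hxy, hxz, hyz⟩ := two_lt_card_iff.1 (not_le.1 h3)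
  have hφ {u : K} (hu : u ∈ Z) : iterateFrobenius K p s u * u = 1 := by
    rw [iterateFrobenius_def, ← pow_succ, hU u hu]
  have hp1 : 1 < p ^ Nat.gcd i s := by omega
  have hle : #(Z.erase x) ≤ p ^ Nat.gcd i s := by
    have hinj : Set.InjOn (fun w => (w - y) * (x - z) / ((x - w) * (z - y))) (Z.erase x) := by
      intro u hu w hw h
      have hu' := sub_ne_zero.2 (ne_of_mem_erase hu).symm
      have hw' := sub_ne_zero.2 (ne_of_mem_erase hw).symm
      have hzy := sub_ne_zero.2 hyz.symm
      dsimp only at h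
      rw [div_eq_div_iff (mul_ne_zero hu' hzy) (mul_ne_zero hw' hzy)] at h
      have : (u - w) * ((x - y) * (x - z) * (z - y)) = 0 := by linear_combination h
      exact sub_eq_zero.1 ((mul_eq_zero.1 this).resolve_right
        (mul_ne_zero (mul_ne_zero (sub_ne_zero.2 hxy) (sub_ne_zero.2 hxz)) hzy))
    rw [← card_image_of_injOn hinj]
    have hX := FiniteField.X_pow_card_sub_X_ne_zero K hp1
    rw [← FiniteField.X_pow_card_sub_X_natDegree_eq K hp1]
    refine (card_le_card ?_).trans ((Multiset.toFinset_card_le _).trans (Polynomial.card_roots' _))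
    intro t ht
    obtain ⟨w, hw, rfl⟩ := mem_image.1 ht
    obtain ⟨hwx, hw⟩ := mem_erase.1 hw
    rw [Multiset.mem_toFinset, Polynomial.mem_roots hX]
    simp only [Polynomial.IsRoot.def, Polynomial.eval_sub, Polynomial.eval_pow,
      Polynomial.eval_X, sub_eq_zero]
    apply pow_prime_pow_gcd_eq_self
    · exact map_crossRatio_of_twistedForm_eq_zero (iterateFrobenius K p i) hne hxy hyz.symm hxz
        hwx.symm (hZ x hx) (hZ y hy) (hZ z hz) (hZ w hw)
    · exact map_crossRatio_of_map_eq_inv (iterateFrobenius K p s) (hφ hx) (hφ hy) (hφ hz) (hφ hw)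
        hwx.symm hyz.symm
  rw [card_erase_of_mem hx] at hle
  omega

/-- A twisted form with three zeros among the `(p ^ s + 1)`-st roots of unity has at least
`p ^ gcd i s + 1` of them. -/
theorem exists_finset_zeros_twistedForm [Fintype K] [DecidableEq K]
    (hm : 1 < p ^ Nat.gcd i s) (hK : Fintype.card K = p ^ (s * 2)) {x y z : K}
    (hxy : x ≠ y) (hzy : z ≠ y) (hxz : x ≠ z)
    (hxU : x ^ (p ^ s + 1) = 1) (hyU : y ^ (p ^ s + 1) = 1) (hzU : z ^ (p ^ s + 1) = 1)
    (hx : twistedForm (iterateFrobenius K p i) A B C E x = 0)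
    (hy : twistedForm (iterateFrobenius K p i) A B C E y = 0)
    (hz : twistedForm (iterateFrobenius K p i) A B C E z = 0) :
    ∃ Z : Finset K, #Z = p ^ Nat.gcd i s + 1 ∧ (∀ w ∈ Z, w ^ (p ^ s + 1) = 1) ∧
      ∀ w ∈ Z, twistedForm (iterateFrobenius K p i) A B C E w = 0 := by
  obtain ⟨T, hT, hTt⟩ := exists_finset_pow_eq_self hK
    ((Nat.gcd_dvd_right i s).mul_right 2) hm
  have hσ {t : K} (ht : t ∈ T) : iterateFrobenius K p i t = t :=
    pow_prime_pow_eq_self_of_dvd (hTt t ht) (Nat.gcd_dvd_left i s)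
  have hφ {t : K} (ht : t ∈ T) : iterateFrobenius K p s t = t :=
    pow_prime_pow_eq_self_of_dvd (hTt t ht) (Nat.gcd_dvd_right i s)
  rw [pow_succ] at hxU hyU hzU
  have hD {t : K} (ht : t ∈ T) : t * (z - y) + (x - z) ≠ 0 :=
    crossRatio_point_denom_ne_zero (iterateFrobenius K p s) hxU hyU hzU (hφ ht) hxy hxz
  have hzy' := sub_ne_zero.2 hzy
  have hxz' := sub_ne_zero.2 hxz
  have hxy' := sub_ne_zero.2 hxy
  refine ⟨insert x (T.image fun t => (t * (z - y) * x + (x - z) * y) / (t * (z - y) + (x - z))),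
    ?_, ?_, ?_⟩
  · rw [card_insert_of_notMem, card_image_of_injOn, hT]
    · intro t ht u hu h
      dsimp only at h
      rw [div_eq_div_iff (hD ht) (hD hu)] at h
      have : (t - u) * ((x - y) * (x - z) * (z - y)) = 0 := by linear_combination h
      exact sub_eq_zero.1 ((mul_eq_zero.1 this).resolve_right
        (mul_ne_zero (mul_ne_zero hxy' hxz') hzy'))
    · intro h
      obtain ⟨t, ht, h⟩ := mem_image.1 h
      rw [div_eq_iff (hD ht)] at h
      exact mul_ne_zero hxz' hxy' (by linear_combination -h)
  · intro w hw
    rcases mem_insert.1 hw with rfl | hw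
    · rwa [pow_succ]
    · obtain ⟨t, ht, rfl⟩ := mem_image.1 hw
      rw [pow_succ]
      exact map_crossRatio_point_mul_self (iterateFrobenius K p s) hxU hyU hzU (hφ ht) (hD ht)
  · intro w hw
    rcases mem_insert.1 hw with rfl | hw
    · exact hx
    · obtain ⟨t, ht, rfl⟩ := mem_image.1 hw
      exact twistedForm_crossRatio_point _ (hσ ht) (hD ht) hx hy hz

/-- Any three columns `(1, x, σ x, σ x * x)` with distinct `x` are linearly independent. -/
theorem eq_zero_of_card_support_le_three {ι : Type*} [Fintype ι] [DecidableEq ι] (σ : K →+* K)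
    {g v : ι → K} (hg : Function.Injective g) {S : Finset ι} (hS : #S ≤ 3)
    (hv : ∀ j ∉ S, v j = 0) (h1 : ∑ j, v j = 0) (h2 : ∑ j, v j * g j = 0)
    (h3 : ∑ j, v j * σ (g j) = 0) (h4 : ∑ j, v j * (σ (g j) * g j) = 0) : v = 0 := by
  funext j₀
  by_contra hj
  have hj₀ : j₀ ∈ S := by
    by_contra h
    exact hj (hv _ h)
  obtain ⟨a, b, ha, hb, hab⟩ : ∃ a b : K, a ≠ g j₀ ∧ b ≠ g j₀ ∧
      ∀ j ∈ S, j ≠ j₀ → g j = a ∨ g j = b := by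
    have hc : #(S.erase j₀) ≤ 2 := by
      rw [card_erase_of_mem hj₀]
      omega
    have h0 : g j₀ + 1 ≠ g j₀ := by simp
    interval_cases hc' : #(S.erase j₀)
    · rw [card_eq_zero] at hc'
      exact ⟨_, _, h0, h0, fun j hj hne => by simpa [hc'] using mem_erase.2 ⟨hne, hj⟩⟩
    · obtain ⟨k, hk⟩ := card_eq_one.1 hc'
      have hkne : k ≠ j₀ := ne_of_mem_erase (s := S) (hk ▸ mem_singleton_self k)
      refine ⟨g k, g k, hg.ne hkne, hg.ne hkne, fun j hj hne => ?_⟩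
      have : j ∈ S.erase j₀ := mem_erase.2 ⟨hne, hj⟩
      simp_all
    · obtain ⟨k, l, -, hkl⟩ := card_eq_two.1 hc'
      have hkne : k ≠ j₀ := ne_of_mem_erase (s := S) (hkl ▸ by simp)
      have hlne : l ≠ j₀ := ne_of_mem_erase (s := S) (hkl ▸ by simp)
      refine ⟨g k, g l, hg.ne hkne, hg.ne hlne, fun j hj hne => ?_⟩
      have : j ∈ S.erase j₀ := mem_erase.2 ⟨hne, hj⟩
      rw [hkl, mem_insert, mem_singleton] at this
      exact this.imp (congrArg g) (congrArg g)
  have hsum : ∑ j, v j * ((σ (g j) - σ a) * (g j - b)) = 0 := by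
    have : ∀ j, v j * ((σ (g j) - σ a) * (g j - b)) =
        v j * (σ (g j) * g j) - b * (v j * σ (g j)) - σ a * (v j * g j) + σ a * b * v j :=
      fun j => by ring
    simp only [this, sum_add_distrib, sum_sub_distrib, ← mul_sum, h1, h2, h3, h4]
    ring
  rw [sum_eq_single j₀] at hsum
  · exact mul_ne_zero hj (mul_ne_zero (sub_ne_zero.2 (σ.injective.ne ha.symm))
      (sub_ne_zero.2 hb.symm)) hsum
  · intro j _ hne
    by_cases hjS : j ∈ S
    · rcases hab j hjS hne with h | h <;> simp [h]
    · simp [hv j hjS]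
  · simp

end Counting

section Duality

variable (F : Type*) {K ι : Type*} [Field F] [Field K] [Algebra F K] (g₁ g₂ : ι → K)

/-- The map sending a word `c` to the pair `(∑ c_j g₁(j), ∑ c_j g₂(j))`. -/
noncomputable def syndromeMap [Fintype ι] : (ι → F) →ₗ[F] K × K :=
  (Fintype.linearCombination F g₁).prod (Fintype.linearCombination F g₂)

/-- The map sending `(a, b)` to the word with coordinates `Tr(a g₁(j) + b g₂(j))`. -/
noncomputable def traceMap : K × K →ₗ[F] (ι → F) :=
  LinearMap.pi fun j => Algebra.trace F K ∘ₗ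
    (LinearMap.mulRight F (g₁ j)).coprod (LinearMap.mulRight F (g₂ j))

variable {F g₁ g₂}

@[simp] theorem syndromeMap_apply [Fintype ι] (c : ι → F) :
    syndromeMap F g₁ g₂ c =
      (∑ j, algebraMap F K (c j) * g₁ j, ∑ j, algebraMap F K (c j) * g₂ j) := by
  simp [syndromeMap, Fintype.linearCombination_apply, Algebra.smul_def]

@[simp] theorem traceMap_apply (a b : K) (j : ι) :
    traceMap F g₁ g₂ (a, b) j = Algebra.trace F K (a * g₁ j + b * g₂ j) := by
  simp [traceMap]

theorem trace_syndromeMap [Fintype ι] (a b : K) (c : ι → F) :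
    Algebra.trace F K (a * (syndromeMap F g₁ g₂ c).1 + b * (syndromeMap F g₁ g₂ c).2) =
      ∑ j, c j * traceMap F g₁ g₂ (a, b) j := by
  simp only [syndromeMap_apply, traceMap_apply, mul_sum, ← sum_add_distrib, map_sum]
  refine sum_congr rfl fun j _ => ?_
  rw [← smul_eq_mul (c j), ← map_smul, Algebra.smul_def]
  congr 1
  ring

theorem eq_zero_of_trace_mul_eq_zero [FiniteDimensional F K] [Algebra.IsSeparable F K] {a : K}
    (h : ∀ u, Algebra.trace F K (a * u) = 0) : a = 0 :=
  (traceForm_nondegenerate F K).1 a h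

theorem syndromeMap_surjective_iff [Fintype ι] [FiniteDimensional F K] [Algebra.IsSeparable F K] :
    Function.Surjective (syndromeMap F g₁ g₂) ↔ Function.Injective (traceMap F g₁ g₂) := by
  constructor
  · intro hs
    rw [injective_iff_map_eq_zero]
    rintro ⟨a, b⟩ hab
    have key (u v : K) : Algebra.trace F K (a * u + b * v) = 0 := by
      obtain ⟨c, hc⟩ := hs (u, v)
      have := trace_syndromeMap (g₁ := g₁) (g₂ := g₂) a b c
      rw [hc, hab] at this
      simpa only [Pi.zero_apply, mul_zero, sum_const_zero] using this
    exact Prod.ext (eq_zero_of_trace_mul_eq_zero fun u => by simpa using key u 0)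
      (eq_zero_of_trace_mul_eq_zero fun v => by simpa using key 0 v)
  · intro hi
    classical
    rw [← LinearMap.range_eq_top]
    by_contra hne
    obtain ⟨f, hf0, hf⟩ := Submodule.exists_le_ker_of_lt_top _ (lt_top_iff_ne_top.2 hne)
    let e := (Algebra.traceForm F K).toDual (traceForm_nondegenerate F K)
    have he (φ : Module.Dual F K) (u : K) : Algebra.trace F K (e.symm φ * u) = φ u :=
      LinearMap.BilinForm.apply_toDual_symm_apply (hB := traceForm_nondegenerate F K) φ u
    have hfe (u v : K) : f (u, v) = Algebra.trace F K
        (e.symm (f ∘ₗ LinearMap.inl F K K) * u + e.symm (f ∘ₗ LinearMap.inr F K K) * v) := by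
      rw [map_add, he, he]
      simp [← map_add]
    have h0 : traceMap F g₁ g₂
        (e.symm (f ∘ₗ LinearMap.inl F K K), e.symm (f ∘ₗ LinearMap.inr F K K)) = 0 := by
      funext j
      rw [traceMap_apply, ← hfe]
      have : (g₁ j, g₂ j) = syndromeMap F g₁ g₂ (Pi.single j 1) := by
        simp [Pi.single_apply, apply_ite (algebraMap F K), ite_mul]
      rw [this]
      exact hf ⟨_, rfl⟩
    obtain ⟨ha, hb⟩ := Prod.mk_eq_zero.1 (hi (h0.trans (map_zero _).symm))
    refine hf0 (LinearMap.ext fun uv => ?_)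
    obtain ⟨u, v⟩ := uv
    rw [hfe, ha, hb]
    simp

/-- If a nonzero word `Tr(a g₁ + b g₂)` vanishes on four coordinates, then some nonzero word
supported on these coordinates has zero syndrome. -/
theorem exists_syndromeMap_eq_zero [Fintype ι] [DecidableEq ι] [FiniteDimensional F K]
    [Algebra.IsSeparable F K] (hFK : Module.finrank F K = 2) {ab : K × K} (hab : ab ≠ 0)
    {S : Finset ι} (hS : #S = 4) (hab0 : ∀ j ∈ S, traceMap F g₁ g₂ ab j = 0) :
    ∃ c : ι → F, c ≠ 0 ∧ (∀ j ∉ S, c j = 0) ∧ syndromeMap F g₁ g₂ c = 0 := by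
  have hns : ¬Function.Injective (syndromeMap F (fun j : S => g₁ j) (fun j : S => g₂ j)) := by
    rw [LinearMap.injective_iff_surjective_of_finrank_eq_finrank (by simp [hFK, hS]),
      syndromeMap_surjective_iff, injective_iff_map_eq_zero]
    intro h
    exact hab (h ab (funext fun j => hab0 j j.2))
  rw [injective_iff_map_eq_zero] at hns
  push Not at hns
  obtain ⟨c, hc, hc0⟩ := hns
  have hsum (g : ι → K) :
      ∑ j, algebraMap F K (if hj : j ∈ S then c ⟨j, hj⟩ else 0) * g j =
        ∑ j : S, algebraMap F K (c j) * g j := by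
    rw [← sum_subset (subset_univ S) (fun j _ hj => by simp [hj]), ← sum_coe_sort S]
    simp
  refine ⟨fun j => if hj : j ∈ S then c ⟨j, hj⟩ else 0, fun h => hc0 (funext fun j => ?_),
    fun j hj => dif_neg hj, ?_⟩
  · simpa using congrFun h j
  · rw [syndromeMap_apply] at hc ⊢
    rw [hsum, hsum]
    exact hc

end Duality

section Trace

variable {F K : Type*} [Field F] [Field K] [Fintype F] [Algebra F K]

theorem algebraMap_trace_of_finrank_eq_two [Fintype K] (hFK : Module.finrank F K = 2) (x : K) :
    algebraMap F K (Algebra.trace F K x) = x + x ^ Fintype.card F := by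
  rw [FiniteField.algebraMap_trace_eq_sum_pow, hFK]
  simp [sum_range_succ]

theorem pow_eq_pow_of_add_mul_eq {M : Type*} [Monoid M] {x : M} {n a b c d : ℕ} (hx : x ^ n = 1)
    (h : a + n * c = b + n * d) : x ^ a = x ^ b := by
  have := congrArg (x ^ ·) h
  simpa [pow_add, pow_mul, hx] using this

/-- The exponents `h, h + 1, q h, q (h + 1)` are, modulo `q + 1`, a translate of
`0, 1, Q, Q + 1`. -/
theorem exists_exponent_translate {M : Type*} [Monoid M] {q Q h : ℕ} (hQ : 0 < Q) (hQq : Q ≤ q)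
    (hh : 2 * h = q - Q ∨ 2 * h = Q - 1) :
    ∃ k, (∀ x : M, x ^ (q + 1) = 1 → x ^ k = x ^ (q * (h + 1)) ∧ x ^ (k + 1) = x ^ (q * h) ∧
        x ^ (k + Q) = x ^ h ∧ x ^ (k + Q + 1) = x ^ (h + 1)) ∨
      (∀ x : M, x ^ (q + 1) = 1 → x ^ k = x ^ h ∧ x ^ (k + 1) = x ^ (h + 1) ∧
        x ^ (k + Q) = x ^ (q * (h + 1)) ∧ x ^ (k + Q + 1) = x ^ (q * h)) := by
  rcases hh with hh | hh
  · obtain rfl : q = Q + 2 * h := by omega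
    refine ⟨h, Or.inr fun x hx => ⟨rfl, rfl, ?_, ?_⟩⟩
    · exact pow_eq_pow_of_add_mul_eq (c := h) (d := 0) hx (by ring)
    · exact pow_eq_pow_of_add_mul_eq (c := h) (d := 1) hx (by ring)
  · obtain rfl : Q = 2 * h + 1 := by omega
    refine ⟨q * (h + 1), Or.inl fun x hx => ⟨rfl, ?_, ?_, ?_⟩⟩
    · exact pow_eq_pow_of_add_mul_eq (c := 0) (d := 1) hx (by ring)
    · exact pow_eq_pow_of_add_mul_eq (c := 0) (d := h + 1) hx (by ring)
    · exact pow_eq_pow_of_add_mul_eq (c := 0) (d := h + 1) hx (by ring)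

variable {p s i h : ℕ} [Fact p.Prime] [CharP K p]

/-- On the `(p ^ s + 1)`-st roots of unity, the words `Tr(a x^h + b x^(h+1))` vanish where twisted
forms do. -/
theorem exists_twistedForm_of_trace [Fintype K] (hF : Fintype.card F = p ^ s)
    (hFK : Module.finrank F K = 2) (his : i ≤ s) (hh : 2 * h = p ^ s - p ^ i ∨ 2 * h = p ^ i - 1)
    (a b : K) :
    ∃ A B C E : K, (A = 0 ∧ B = 0 ∧ C = 0 ∧ E = 0 → a = 0 ∧ b = 0) ∧
      ∀ x : K, x ^ (p ^ s + 1) = 1 → (Algebra.trace F K (a * x ^ h + b * x ^ (h + 1)) = 0 ↔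
        twistedForm (iterateFrobenius K p i) A B C E x = 0) := by
  have hp := (Fact.out : p.Prime).pos
  have htr (x : K) : algebraMap F K (Algebra.trace F K (a * x ^ h + b * x ^ (h + 1))) =
      a * x ^ h + b * x ^ (h + 1) + a ^ p ^ s * x ^ (p ^ s * h) +
        b ^ p ^ s * x ^ (p ^ s * (h + 1)) := by
    rw [algebraMap_trace_of_finrank_eq_two hFK, hF, add_pow_char_pow, mul_pow, mul_pow,
      ← pow_mul', ← pow_mul']
    ring
  have hiff {x X f : K} (hx : x ≠ 0) (k : ℕ)
      (e : algebraMap F K (Algebra.trace F K X) = x ^ k * f) :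
      Algebra.trace F K X = 0 ↔ f = 0 := by
    rw [← map_eq_zero (algebraMap F K), e, mul_eq_zero, or_iff_right (pow_ne_zero k hx)]
  have hx0 {x : K} (hx : x ^ (p ^ s + 1) = 1) : x ≠ 0 := by
    rintro rfl
    simp at hx
  obtain ⟨k, hk | hk⟩ := exists_exponent_translate (M := K) (pow_pos hp i)
    (Nat.pow_le_pow_right hp his) hh
  · refine ⟨b, a, a ^ p ^ s, b ^ p ^ s, fun H => ⟨H.2.1, H.1⟩, fun x hx => hiff (hx0 hx) k ?_⟩
    obtain ⟨h1, h2, h3, h4⟩ := hk x hx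
    rw [htr, ← h1, ← h2, ← h3, ← h4, twistedForm, iterateFrobenius_def]
    ring
  · refine ⟨a ^ p ^ s, b ^ p ^ s, b, a, fun H => ⟨H.2.2.2, H.2.2.1⟩,
      fun x hx => hiff (hx0 hx) k ?_⟩
    obtain ⟨h1, h2, h3, h4⟩ := hk x hx
    rw [htr, ← h1, ← h2, ← h3, ← h4, twistedForm, iterateFrobenius_def]
    ring

/-- A word with zero syndrome and at most three nonzero coordinates vanishes. -/
theorem eq_zero_of_syndromeMap_eq_zero {ι : Type*} [Fintype ι] [DecidableEq ι]
    (hF : Fintype.card F = p ^ s) (his : i ≤ s)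
    (hh : 2 * h = p ^ s - p ^ i ∨ 2 * h = p ^ i - 1) {g : ι → K} (hg : Function.Injective g)
    (hgU : ∀ j, g j ^ (p ^ s + 1) = 1) {c : ι → F}
    (hc : syndromeMap F (fun j => g j ^ h) (fun j => g j ^ (h + 1)) c = 0)
    {S : Finset ι} (hS : #S ≤ 3) (hcS : ∀ j ∉ S, c j = 0) : c = 0 := by
  have hp := (Fact.out : p.Prime).pos
  have hg0 (j : ι) : g j ≠ 0 := by
    intro h0
    simpa [h0] using hgU j
  have hfrob {e : ℕ} (H : ∑ j, algebraMap F K (c j) * g j ^ e = 0) :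
      ∑ j, algebraMap F K (c j) * g j ^ (p ^ s * e) = 0 := by
    have := congrArg (iterateFrobenius K p s) H
    simp only [map_sum, map_mul, map_pow, map_zero] at this
    rw [← this]
    refine sum_congr rfl fun j _ => ?_
    rw [iterateFrobenius_def, iterateFrobenius_def, ← map_pow, ← hF, FiniteField.pow_card, pow_mul]
  rw [syndromeMap_apply] at hc
  obtain ⟨e1, e2⟩ := Prod.mk.inj hc
  have e3 := hfrob e1
  have e4 := hfrob e2
  have main (k : ℕ) (h1 : ∑ j, algebraMap F K (c j) * g j ^ k = 0)
      (h2 : ∑ j, algebraMap F K (c j) * g j ^ (k + 1) = 0)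
      (h3 : ∑ j, algebraMap F K (c j) * g j ^ (k + p ^ i) = 0)
      (h4 : ∑ j, algebraMap F K (c j) * g j ^ (k + p ^ i + 1) = 0) : c = 0 := by
    have := eq_zero_of_card_support_le_three (iterateFrobenius K p i) hg
      (v := fun j => algebraMap F K (c j) * g j ^ k) hS (fun j hj => by simp [hcS j hj]) h1
      (by simpa only [pow_succ, mul_assoc] using h2)
      (by simpa only [pow_add, mul_assoc, iterateFrobenius_def] using h3)
      (by simpa only [pow_add, pow_one, mul_assoc, iterateFrobenius_def] using h4)
    funext j
    have hj := congrFun this j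
    simpa [hg0 j] using hj
  obtain ⟨k, hk | hk⟩ := exists_exponent_translate (M := K) (pow_pos hp i)
    (Nat.pow_le_pow_right hp his) hh
  all_goals
    apply main k
    · simpa only [(hk _ (hgU _)).1]
    · simpa only [(hk _ (hgU _)).2.1]
    · simpa only [(hk _ (hgU _)).2.2.1]
    · simpa only [(hk _ (hgU _)).2.2.2]

end Trace

theorem stmt6 (p s : ℕ) (hp : p.Prime) (hs : 1 < s) (q : ℕ) (hq : q = p ^ s)
    (i m : ℕ) (hi0 : 0 < i) (his : i < s) (hm : m = Nat.gcd i s) (hpm : 3 ≤ p ^ m)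
    (h : ℕ) (hh : 2 * h = q - p ^ i ∨ (Odd p ∧ 2 * h = p ^ i - 1))
    (F K : Type) [Field F] [Field K] [Fintype F] [Fintype K] [DecidableEq F]
    [Algebra F K] (hF : Fintype.card F = q) (hK : Fintype.card K = q ^ 2)
    (β : K) (hβ : IsPrimitiveRoot β (q + 1))
    (C : Set (Fin (q + 1) → F))
    (hC : C = {c | (∑ j : Fin (q + 1), algebraMap F K (c j) * β ^ (h * (j : ℕ)) = 0) ∧
      (∑ j : Fin (q + 1), algebraMap F K (c j) * β ^ ((h + 1) * (j : ℕ)) = 0)})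
    (D : Set (Fin (q + 1) → F))
    (hD : D = {c | ∃ a b : K, ∀ j : Fin (q + 1),
      c j = Algebra.trace F K (a * β ^ (h * (j : ℕ)) + b * β ^ ((h + 1) * (j : ℕ)))}) :
    C.ncard = q ^ (q - 3) ∧
    IsLeast {w : ℕ | ∃ c ∈ C, c ≠ 0 ∧ hammingNorm c = w} 4 ∧
    D.ncard = q ^ 4 ∧
    IsLeast {w : ℕ | ∃ c ∈ D, c ≠ 0 ∧ hammingNorm c = w} (q - p ^ m) := by
  classical
  have : Fact p.Prime := ⟨hp⟩
  subst hq hm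
  have hp0 := hp.pos
  have hcharK : CharP K p := charP_of_card_eq_prime_pow (hK.trans (pow_mul p s 2).symm)
  have hFK : Module.finrank F K = 2 := by
    have h1 := Module.card_eq_pow_finrank (K := F) (V := K)
    rw [hK, hF] at h1
    exact (Nat.pow_right_injective (hF ▸ Fintype.one_lt_card (α := F)) h1).symm
  have hh' : 2 * h = p ^ s - p ^ i ∨ 2 * h = p ^ i - 1 := hh.imp_right And.right
  have hmq : p ^ Nat.gcd i s < p ^ s := Nat.pow_lt_pow_right hp.one_lt
    ((Nat.gcd_le_left s hi0).trans_lt his)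
  obtain ⟨g, hg⟩ : ∃ g : Fin (p ^ s + 1) → K, g = fun j : Fin (p ^ s + 1) => β ^ (j : ℕ) :=
    ⟨_, rfl⟩
  have hginj : Function.Injective g := fun j k hjk =>
    Fin.ext (hβ.pow_inj j.2 k.2 (by simpa [hg] using hjk))
  have hgU (j) : g j ^ (p ^ s + 1) = 1 := by
    rw [hg, ← pow_mul, mul_comm, pow_mul, hβ.pow_eq_one, one_pow]
  obtain ⟨syn, hsyn⟩ : ∃ syn, syn = syndromeMap F (fun j => g j ^ h) (fun j => g j ^ (h + 1)) :=
    ⟨_, rfl⟩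
  obtain ⟨tr, htr⟩ : ∃ tr, tr = traceMap F (fun j => g j ^ h) (fun j => g j ^ (h + 1)) :=
    ⟨_, rfl⟩
  have hC' : C = (LinearMap.ker syn : Set (Fin (p ^ s + 1) → F)) := by
    ext c
    simp [hC, hsyn, hg, ← pow_mul']
  have hD' : D = (LinearMap.range tr : Set (Fin (p ^ s + 1) → F)) := by
    ext c
    simp [hD, htr, hg, ← pow_mul', funext_iff, eq_comm]
  have hform (ab : K × K) : ∃ A B C E : K, (ab ≠ 0 → ¬(A = 0 ∧ B = 0 ∧ C = 0 ∧ E = 0)) ∧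
      ∀ j, tr ab j = 0 ↔ twistedForm (iterateFrobenius K p i) A B C E (g j) = 0 := by
    obtain ⟨a, b⟩ := ab
    obtain ⟨A, B, C, E, h0, h1⟩ := exists_twistedForm_of_trace hF hFK his.le hh' a b
    refine ⟨A, B, C, E, fun hab H => hab (Prod.ext (h0 H).1 (h0 H).2), fun j => ?_⟩
    rw [htr, traceMap_apply, h1 _ (hgU j)]
  have hzeros {ab : K × K} (hab : ab ≠ 0) :
      #(univ.filter fun j => tr ab j = 0) ≤ p ^ Nat.gcd i s + 1 := by
    obtain ⟨A, B, C, E, hne, hz⟩ := hform ab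
    rw [← card_image_of_injective _ hginj]
    refine card_zeros_twistedForm_le hpm (hne hab) _ (fun z hz' => ?_) (fun z hz' => ?_)
    all_goals
      obtain ⟨j, hj, rfl⟩ := mem_image.1 hz'
    · exact hgU j
    · exact (hz j).1 (mem_filter.1 hj).2
  have hinj : Function.Injective tr := by
    rw [injective_iff_map_eq_zero]
    intro ab hab
    by_contra hne
    have := hzeros hne
    simp only [hab, Pi.zero_apply, filter_true, card_univ, Fintype.card_fin] at this
    omega
  have hsurj : Function.Surjective syn := by
    rw [hsyn, syndromeMap_surjective_iff, ← htr]
    exact hinj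
  have hnorm (c : Fin (p ^ s + 1) → F) :
      #(univ.filter fun j => c j = 0) + hammingNorm c = p ^ s + 1 := by
    rw [hammingNorm, card_filter_add_card_filter_not, card_univ, Fintype.card_fin]
  obtain ⟨ab, hab, hab_card⟩ : ∃ ab : K × K, ab ≠ 0 ∧
      #(univ.filter fun j => tr ab j = 0) = p ^ Nat.gcd i s + 1 := by
    have hcard : 3 ≤ p ^ s + 1 := by omega
    have hker : LinearMap.ker ((LinearMap.funLeft F F (Fin.castLE hcard)).comp tr) ≠ ⊥ :=
      LinearMap.ker_ne_bot_of_finrank_lt (by simp [hFK])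
    obtain ⟨ab, hab, hab0⟩ := Submodule.exists_mem_ne_zero_of_ne_bot hker
    obtain ⟨A, B, C, E, hne, hz⟩ := hform ab
    have hab' (k : Fin 3) : tr ab (Fin.castLE hcard k) = 0 := congrFun hab k
    have hdist {k l : Fin 3} (hkl : k ≠ l) : g (Fin.castLE hcard k) ≠ g (Fin.castLE hcard l) :=
      hginj.ne ((Fin.castLE_injective hcard).ne hkl)
    obtain ⟨Z, hZ, hZU, hZ0⟩ := exists_finset_zeros_twistedForm (i := i) (by omega : 1 < _)
      (hK.trans (pow_mul p s 2).symm) (hdist (by decide : (0 : Fin 3) ≠ 1))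
      (hdist (by decide : (2 : Fin 3) ≠ 1)) (hdist (by decide : (0 : Fin 3) ≠ 2))
      (hgU _) (hgU _) (hgU _) ((hz _).1 (hab' 0)) ((hz _).1 (hab' 1)) ((hz _).1 (hab' 2))
    refine ⟨ab, hab0, (hzeros hab0).antisymm ?_⟩
    rw [← hZ, ← card_image_of_injective _ hginj]
    refine card_le_card fun w hw => ?_
    obtain ⟨k, hk, rfl⟩ := hβ.eq_pow_of_pow_eq_one (hZU w hw)
    exact mem_image.2 ⟨⟨k, hk⟩, mem_filter.2 ⟨mem_univ _, (hz _).2 (by simpa [hg] using hZ0 _ hw)⟩,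
      by simp [hg]⟩
  refine ⟨?_, ⟨?_, ?_⟩, ?_, ⟨?_, ?_⟩⟩
  · have hfin : Module.finrank F (LinearMap.ker syn) = p ^ s - 3 := by
      have h1 := syn.finrank_range_add_finrank_ker
      rw [LinearMap.range_eq_top.2 hsurj, finrank_top, Module.finrank_prod, hFK,
        Module.finrank_fin_fun] at h1
      omega
    rw [hC', ← Nat.card_coe_set_eq]
    change Nat.card (LinearMap.ker syn) = _
    rw [Module.natCard_eq_pow_finrank (K := F), hfin, Nat.card_eq_fintype_card, hF]
  · obtain ⟨S, hS, hS4⟩ := exists_subset_card_eq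
      (show 4 ≤ #(univ.filter fun j => tr ab j = 0) by omega)
    obtain ⟨c, hc0, hcS, hc⟩ := exists_syndromeMap_eq_zero (g₁ := fun j => g j ^ h)
      (g₂ := fun j => g j ^ (h + 1)) hFK hab hS4
      (fun j hj => by rw [← htr]; exact (mem_filter.1 (hS hj)).2)
    refine ⟨c, by rw [hC', hsyn]; exact hc, hc0, le_antisymm ?_ ?_⟩
    · rw [← hS4]
      refine card_le_card fun j hj => ?_
      by_contra hjS
      exact (mem_filter.1 hj).2 (hcS j hjS)
    · by_contra hlt
      exact hc0 (eq_zero_of_syndromeMap_eq_zero hF his.le hh' hginj hgU hc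
        (S := univ.filter fun j => c j ≠ 0) (Nat.le_of_lt_succ (not_le.1 hlt))
        (fun j hj => by simpa using hj))
  · rintro w ⟨c, hc, hc0, rfl⟩
    rw [hC', hsyn] at hc
    by_contra hlt
    exact hc0 (eq_zero_of_syndromeMap_eq_zero hF his.le hh' hginj hgU hc
      (S := univ.filter fun j => c j ≠ 0) (Nat.le_of_lt_succ (not_le.1 hlt))
      (fun j hj => by simpa using hj))
  · rw [hD', LinearMap.coe_range, ← Set.image_univ, Set.ncard_image_of_injective _ hinj,
      Set.ncard_univ, Nat.card_prod, Nat.card_eq_fintype_card, hK]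
    ring
  · refine ⟨tr ab, by rw [hD']; exact ⟨ab, rfl⟩, (map_ne_zero_iff tr hinj).2 hab, ?_⟩
    have := hnorm (tr ab)
    omega
  · rintro w ⟨c, hc, hc0, rfl⟩
    rw [hD'] at hc
    obtain ⟨ab, rfl⟩ := hc
    have := hzeros ((map_ne_zero_iff tr hinj).1 hc0)
    have := hnorm (tr ab)
    omega
end

section
/- Let q = 3^s with s > 1 an integer, let 0 < i < s with gcd(i, s) = 1, and let h = (q − 3^i)/2 or h = (3^i − 1)/2. Then the BCH code C_h is a near MDS code with parameters [q + 1, q − 3, 4]: it contains exactly q^{q−3} codewords and its minimum distance is exactly 4; and its dual code D_h has parameters [q + 1, 4, q − 3]: it contains exactly q^4 codewords and its minimum distance is exactly q − 3. -/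
section BilinearForms

variable {K : Type*} [Field K]

theorem bilinear_form_four_zeros {A B C D x₁ x₂ x₃ x₄ y₁ y₂ y₃ y₄ : K}
    (hne : ¬ (A = 0 ∧ B = 0 ∧ C = 0 ∧ D = 0)) (hy : y₂ ≠ y₃)
    (h₁ : A * x₁ * y₁ + B * y₁ + C * x₁ + D = 0) (h₂ : A * x₂ * y₂ + B * y₂ + C * x₂ + D = 0)
    (h₃ : A * x₃ * y₃ + B * y₃ + C * x₃ + D = 0) (h₄ : A * x₄ * y₄ + B * y₄ + C * x₄ + D = 0) :
    (x₁ - x₂) * (y₁ - y₃) * ((x₄ - x₃) * (y₄ - y₂)) =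
      (x₁ - x₃) * (y₁ - y₂) * ((x₄ - x₂) * (y₄ - y₃)) := by
  have hu : ∀ x y : K, A * x * y + B * y + C * x + D = 0 →
      (C + y₂ * A) * ((x - x₂) * (y - y₃)) - (C + y₃ * A) * ((x - x₃) * (y - y₂)) = 0 := by
    intro x y h
    linear_combination (y₂ - y₃) * h + y * (h₃ - h₂) + y₃ * h₂ - y₂ * h₃
  have u₁ := hu _ _ h₁
  have u₄ := hu _ _ h₄
  by_contra hΔ
  rw [← sub_eq_zero] at hΔ
  have hα : C + y₂ * A = 0 := by
    refine (mul_eq_zero.1 ?_).resolve_right hΔ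
    linear_combination ((x₄ - x₃) * (y₄ - y₂)) * u₁ - ((x₁ - x₃) * (y₁ - y₂)) * u₄
  have hβ : C + y₃ * A = 0 := by
    refine (mul_eq_zero.1 ?_).resolve_right hΔ
    linear_combination ((x₄ - x₂) * (y₄ - y₃)) * u₁ - ((x₁ - x₂) * (y₁ - y₃)) * u₄
  have hy' := sub_ne_zero.2 hy
  have hA : A = 0 := (mul_eq_zero.1 (by linear_combination hα - hβ)).resolve_left hy'
  have hC : C = 0 := by simpa [hA] using hα
  subst hA hC
  have hB : B = 0 := (mul_eq_zero.1 (by linear_combination h₂ - h₃)).resolve_left hy'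
  exact hne ⟨rfl, hB, rfl, by simpa [hB] using h₂⟩

theorem pow_char_eq_self_of_coprime (p : ℕ) [ExpChar K p] {m n : ℕ} (hmn : Nat.gcd m n = 1)
    {r : K} (hm : r ^ p ^ m = r) (hn : r ^ p ^ n = r) : r ^ p = r := by
  have h₁ : Function.IsPeriodicPt (frobenius K p) m r := (iterate_frobenius p m r).trans hm
  have h₂ : Function.IsPeriodicPt (frobenius K p) n r := (iterate_frobenius p n r).trans hn
  have := h₁.gcd h₂
  rw [hmn] at this
  simpa [Function.IsPeriodicPt, Function.IsFixedPt, frobenius_def] using this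

theorem ne_zero_of_pow_succ_eq_one {n : ℕ} {x : K} (hx : x ^ (n + 1) = 1) : x ≠ 0 := by
  rintro rfl
  simp at hx

theorem harmonic_of_form_zeros [CharP K 3] {s i : ℕ} (his : Nat.gcd i s = 1)
    {A B C D x₁ x₂ x₃ x₄ : K} (hne : ¬ (A = 0 ∧ B = 0 ∧ C = 0 ∧ D = 0))
    (u₁ : x₁ ^ (3 ^ s + 1) = 1) (u₂ : x₂ ^ (3 ^ s + 1) = 1) (u₃ : x₃ ^ (3 ^ s + 1) = 1)
    (u₄ : x₄ ^ (3 ^ s + 1) = 1)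
    (h₁₂ : x₁ ≠ x₂) (h₁₃ : x₁ ≠ x₃) (h₂₃ : x₂ ≠ x₃) (h₁₄ : x₁ ≠ x₄) (h₂₄ : x₂ ≠ x₄) (h₃₄ : x₃ ≠ x₄)
    (h₁ : A * x₁ * x₁ ^ 3 ^ i + B * x₁ ^ 3 ^ i + C * x₁ + D = 0)
    (h₂ : A * x₂ * x₂ ^ 3 ^ i + B * x₂ ^ 3 ^ i + C * x₂ + D = 0)
    (h₃ : A * x₃ * x₃ ^ 3 ^ i + B * x₃ ^ 3 ^ i + C * x₃ + D = 0)
    (h₄ : A * x₄ * x₄ ^ 3 ^ i + B * x₄ ^ 3 ^ i + C * x₄ + D = 0) :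
    (x₁ - x₃) * (x₄ - x₂) = - ((x₁ - x₂) * (x₄ - x₃)) := by
  have : Fact (Nat.Prime 3) := ⟨Nat.prime_three⟩
  have hne' : ∀ {x y : K}, x ≠ y → x - y ≠ 0 := fun h => sub_ne_zero.2 h
  have hQ : ∀ x y : K, x ^ 3 ^ i - y ^ 3 ^ i = (x - y) ^ 3 ^ i := fun x y =>
    (sub_pow_char_pow x y i).symm
  have hconj : ∀ {x y : K}, x ^ (3 ^ s + 1) = 1 → y ^ (3 ^ s + 1) = 1 →
      (x - y) ^ 3 ^ s = (y - x) / (x * y) := by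
    intro x y hx hy
    have hx0 := ne_zero_of_pow_succ_eq_one hx
    have hy0 := ne_zero_of_pow_succ_eq_one hy
    rw [pow_succ] at hx hy
    rw [sub_pow_char_pow, eq_div_iff (mul_ne_zero hx0 hy0)]
    linear_combination y * hx - x * hy
  have hy : x₂ ^ 3 ^ i ≠ x₃ ^ 3 ^ i := by
    rw [← sub_ne_zero, hQ]
    exact pow_ne_zero _ (hne' h₂₃)
  have key := bilinear_form_four_zeros hne hy h₁ h₂ h₃ h₄
  simp only [hQ] at key
  have d₁₂ := hne' h₁₂
  have d₁₃ := hne' h₁₃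
  have d₄₂ := hne' h₂₄.symm
  have d₄₃ := hne' h₃₄.symm
  obtain ⟨r, hr⟩ : ∃ r, r = (x₁ - x₃) * (x₄ - x₂) / ((x₁ - x₂) * (x₄ - x₃)) := ⟨_, rfl⟩
  have hri : r ^ 3 ^ i = r := by
    rw [hr, div_pow, mul_pow, mul_pow, div_eq_div_iff
      (mul_ne_zero (pow_ne_zero _ d₁₂) (pow_ne_zero _ d₄₃)) (mul_ne_zero d₁₂ d₄₃)]
    linear_combination key
  have hrs : r ^ 3 ^ s = r := by
    have a₁ := ne_zero_of_pow_succ_eq_one u₁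
    have a₂ := ne_zero_of_pow_succ_eq_one u₂
    have a₃ := ne_zero_of_pow_succ_eq_one u₃
    have a₄ := ne_zero_of_pow_succ_eq_one u₄
    have e₁ := hne' h₁₂.symm
    have e₂ := hne' h₃₄
    rw [hr, div_pow, mul_pow, mul_pow, hconj u₁ u₃, hconj u₄ u₂, hconj u₁ u₂, hconj u₄ u₃]
    field_simp
    ring
  have hr3 := pow_char_eq_self_of_coprime 3 his hri hrs
  have hr0 : r ≠ 0 := by
    rw [hr]
    exact div_ne_zero (mul_ne_zero d₁₃ d₄₂) (mul_ne_zero d₁₂ d₄₃)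
  have hr1 : r - 1 ≠ 0 := by
    intro h
    rw [sub_eq_zero, hr, div_eq_one_iff_eq (mul_ne_zero d₁₂ d₄₃)] at h
    refine mul_ne_zero (hne' h₁₄) (hne' h₂₃) ?_
    linear_combination -h
  have hr' : r + 1 = 0 := by
    refine (mul_eq_zero.1 ?_).resolve_left (mul_ne_zero hr0 hr1)
    linear_combination hr3
  have : r = -1 := by linear_combination hr'
  rw [hr, div_eq_iff (mul_ne_zero d₁₂ d₄₃)] at this
  linear_combination this

theorem card_form_zeros_le_four [CharP K 3] {s i : ℕ} (his : Nat.gcd i s = 1)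
    {A B C D : K} (hne : ¬ (A = 0 ∧ B = 0 ∧ C = 0 ∧ D = 0)) (S : Finset K)
    (hS : ∀ x ∈ S, x ^ (3 ^ s + 1) = 1 ∧ A * x * x ^ 3 ^ i + B * x ^ 3 ^ i + C * x + D = 0) :
    S.card ≤ 4 := by
  classical
  by_contra! hc
  obtain ⟨x₁, m₁, x₂, m₂, x₃, m₃, h₁₂, h₁₃, h₂₃⟩ := Finset.two_lt_card.1 (by omega : 2 < S.card)
  have hT : 1 < (S \ {x₁, x₂, x₃}).card := by
    have := Finset.le_card_sdiff {x₁, x₂, x₃} S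
    have := Finset.card_le_three (a := x₁) (b := x₂) (c := x₃)
    omega
  obtain ⟨x₄, m₄, x₅, m₅, h₄₅⟩ := Finset.one_lt_card.1 hT
  simp only [Finset.mem_sdiff, Finset.mem_insert, Finset.mem_singleton, not_or] at m₄ m₅
  have harm : ∀ x, x ∈ S ∧ ¬ x = x₁ ∧ ¬ x = x₂ ∧ ¬ x = x₃ →
      (x₁ - x₃) * (x - x₂) = - ((x₁ - x₂) * (x - x₃)) := fun x hx =>
    harmonic_of_form_zeros his hne (hS _ m₁).1 (hS _ m₂).1 (hS _ m₃).1 (hS _ hx.1).1 h₁₂ h₁₃ h₂₃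
      (Ne.symm hx.2.1) (Ne.symm hx.2.2.1) (Ne.symm hx.2.2.2)
      (hS _ m₁).2 (hS _ m₂).2 (hS _ m₃).2 (hS _ hx.1).2
  have e₄ := harm _ m₄
  have e₅ := harm _ m₅
  refine mul_ne_zero (mul_ne_zero (sub_ne_zero.2 h₄₅) (sub_ne_zero.2 h₂₃)) (sub_ne_zero.2 h₁₂) ?_
  have hlin : (x₄ - x₅) * (2 * x₁ - x₂ - x₃) = 0 := by linear_combination e₄ - e₅
  have h0 := (mul_eq_zero.1 hlin).resolve_left (sub_ne_zero.2 h₄₅)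
  have hd : (x₁ - x₂) * (x₂ - x₃) = 0 := by
    linear_combination e₄ - (x₄ - x₂) * h0
  linear_combination (x₄ - x₅) * hd

end BilinearForms

section BCHCode

theorem pow_add_mul_of_pow_eq_one {M : Type*} [Monoid M] {x : M} {n : ℕ} (hx : x ^ n = 1)
    {a b : ℕ} (t : ℕ) (hab : a = b + n * t) : x ^ a = x ^ b := by
  rw [hab, pow_add, pow_mul, hx, one_pow, mul_one]

theorem exists_exponent_shift (M : Type*) [Monoid M] {q Q h : ℕ} (hQ : Q ≤ q) (hQ1 : 1 ≤ Q)
    (hh : 2 * h = q - Q ∨ 2 * h = Q - 1) :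
    ∃ k, (∀ x : M, x ^ (q + 1) = 1 → x ^ k = x ^ ((h + 1) * q) ∧ x ^ (k + 1) = x ^ (h * q) ∧
        x ^ (k + Q) = x ^ h ∧ x ^ (k + Q + 1) = x ^ (h + 1)) ∨
      (∀ x : M, x ^ (q + 1) = 1 → x ^ k = x ^ h ∧ x ^ (k + 1) = x ^ (h + 1) ∧
        x ^ (k + Q) = x ^ ((h + 1) * q) ∧ x ^ (k + Q + 1) = x ^ (h * q)) := by
  rcases hh with hh | hh
  · obtain rfl : q = 2 * h + Q := by omega
    refine ⟨h, Or.inr fun x hx => ⟨rfl, rfl, ?_, ?_⟩⟩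
    · exact (pow_add_mul_of_pow_eq_one hx h (by ring)).symm
    · rcases h with - | h
      · simpa using hx
      · exact (pow_add_mul_of_pow_eq_one hx h (by ring)).symm
  · obtain rfl : Q = 2 * h + 1 := by omega
    refine ⟨(h + 1) * q, Or.inl fun x hx => ⟨rfl, ?_, ?_, ?_⟩⟩
    · exact pow_add_mul_of_pow_eq_one hx 1 (by ring)
    · exact pow_add_mul_of_pow_eq_one hx (h + 1) (by ring)
    · exact pow_add_mul_of_pow_eq_one hx (h + 1) (by ring)

theorem hammingNorm_add_card_zeros {ι M : Type*} [Fintype ι] [Zero M] [DecidableEq M] (c : ι → M) :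
    hammingNorm c + (Finset.univ.filter fun j => c j = 0).card = Fintype.card ι := by
  rw [add_comm, hammingNorm, Finset.card_filter_add_card_filter_not, Finset.card_univ]

variable {F K : Type*} [Field F] [Field K] [Algebra F K]

/-- The dual codeword with parameters `a, b`, as a linear function of `(a, b)`. -/
noncomputable def traceWord (F : Type*) {K : Type*} [Field F] [Field K] [Algebra F K] {ι : Type*}
    (x : ι → K) (h : ℕ) : K × K →ₗ[F] ι → F :=
  LinearMap.pi fun j => (Algebra.trace F K).comp
    ((LinearMap.mulRight F (x j ^ h)).coprod (LinearMap.mulRight F (x j ^ (h + 1))))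

theorem traceWord_apply {ι : Type*} (x : ι → K) (h : ℕ) (p : K × K) (j : ι) :
    traceWord F x h p j = Algebra.trace F K (p.1 * x j ^ h + p.2 * x j ^ (h + 1)) := by
  simp [traceWord]

/-- The pair of power sums whose vanishing defines the BCH code. -/
noncomputable def syndrome (F : Type*) {K : Type*} [Field F] [Field K] [Algebra F K] {ι : Type*}
    [Fintype ι] (x : ι → K) (h : ℕ) : (ι → F) →ₗ[F] K × K :=
  Fintype.linearCombination F fun j => (x j ^ h, x j ^ (h + 1))

theorem syndrome_eq_zero_iff {ι : Type*} [Fintype ι] (x : ι → K) (h : ℕ) (c : ι → F) :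
    syndrome F x h c = 0 ↔ ∑ j, algebraMap F K (c j) * x j ^ h = 0 ∧
      ∑ j, algebraMap F K (c j) * x j ^ (h + 1) = 0 := by
  simp [syndrome, Fintype.linearCombination_apply, Prod.ext_iff, Prod.fst_sum, Prod.snd_sum,
    Algebra.smul_def]

variable [Fintype F] [Fintype K]

theorem finrank_eq_two_of_card {q : ℕ} (hF : Fintype.card F = q) (hK : Fintype.card K = q ^ 2) :
    Module.finrank F K = 2 := by
  have h := Module.card_eq_pow_finrank (K := F) (V := K)
  rw [hK, hF] at h
  exact (Nat.pow_right_injective (hF ▸ Fintype.one_lt_card) h).symm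

theorem algebraMap_trace_of_card_sq {q : ℕ} (hF : Fintype.card F = q)
    (hK : Fintype.card K = q ^ 2) (z : K) :
    algebraMap F K (Algebra.trace F K z) = z + z ^ q := by
  rw [FiniteField.algebraMap_trace_eq_sum_pow, finrank_eq_two_of_card hF hK,
    Nat.card_eq_fintype_card, hF]
  simp [Finset.sum_range_succ]

theorem trace_pow_of_card_sq {q : ℕ} (hF : Fintype.card F = q)
    (hK : Fintype.card K = q ^ 2) (z : K) :
    Algebra.trace F K (z ^ q) = Algebra.trace F K z := by
  apply (algebraMap F K).injective
  rw [algebraMap_trace_of_card_sq hF hK, algebraMap_trace_of_card_sq hF hK, ← pow_mul, ← sq,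
    ← hK, FiniteField.pow_card, add_comm]

theorem card_traceWord_zeros_le {s q i h : ℕ} (hq : q = 3 ^ s) (his : i < s)
    (him : Nat.gcd i s = 1) (hh : 2 * h = q - 3 ^ i ∨ 2 * h = 3 ^ i - 1)
    (hF : Fintype.card F = q) (hK : Fintype.card K = q ^ 2) {ι : Type*} [Fintype ι]
    [DecidableEq F] {x : ι → K} (hx : Function.Injective x) (hxq : ∀ j, x j ^ (q + 1) = 1)
    {p : K × K} (hp : p ≠ 0) :
    (Finset.univ.filter fun j => traceWord F x h p j = 0).card ≤ 4 := by
  classical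
  have : Fact (Nat.Prime 3) := ⟨Nat.prime_three⟩
  have : CharP K 3 := charP_of_card_eq_prime_pow (f := s * 2) (by rw [hK, hq, pow_mul])
  have hQ : 3 ^ i ≤ q := hq ▸ Nat.pow_le_pow_right (by norm_num) his.le
  obtain ⟨a, b⟩ := p
  have hzero : ∀ j, traceWord F x h (a, b) j = 0 →
      a * x j ^ h + b * x j ^ (h + 1) + a ^ q * x j ^ (h * q) +
        b ^ q * x j ^ ((h + 1) * q) = 0 := by
    intro j hj
    have h1 := congrArg (algebraMap F K) hj
    rw [traceWord_apply, algebraMap_trace_of_card_sq hF hK, map_zero, hq, add_pow_char_pow,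
      mul_pow, mul_pow, ← pow_mul, ← pow_mul, ← hq] at h1
    linear_combination h1
  have hq0 : q ≠ 0 := by rw [hq]; positivity
  rw [← Finset.card_image_of_injective _ hx]
  have hp' : ¬ (a = 0 ∧ b = 0) := fun h => hp (by simp [h.1, h.2])
  obtain ⟨k, hk | hk⟩ := exists_exponent_shift K hQ (Nat.one_le_pow _ _ (by norm_num)) hh
  · refine card_form_zeros_le_four (A := b) (B := a) (C := a ^ q) (D := b ^ q) him
      (fun h => hp' ⟨h.2.1, h.1⟩) _ ?_
    simp only [Finset.mem_image, Finset.mem_filter, Finset.mem_univ, true_and,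
      forall_exists_index, and_imp]
    rintro y j hj rfl
    refine ⟨hq ▸ hxq j, ?_⟩
    have hx0 := pow_ne_zero k (ne_zero_of_pow_succ_eq_one (hxq j))
    refine (mul_eq_zero.1 ?_).resolve_left hx0
    obtain ⟨e₁, e₂, e₃, e₄⟩ := hk _ (hxq j)
    have hz := hzero j hj
    rw [← e₁, ← e₂, ← e₃, ← e₄] at hz
    linear_combination hz
  · refine card_form_zeros_le_four (A := a ^ q) (B := b ^ q) (C := b) (D := a) him
      (fun h => hp' ⟨h.2.2.2, h.2.2.1⟩) _ ?_
    simp only [Finset.mem_image, Finset.mem_filter, Finset.mem_univ, true_and,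
      forall_exists_index, and_imp]
    rintro y j hj rfl
    refine ⟨hq ▸ hxq j, ?_⟩
    have hx0 := pow_ne_zero k (ne_zero_of_pow_succ_eq_one (hxq j))
    refine (mul_eq_zero.1 ?_).resolve_left hx0
    obtain ⟨e₁, e₂, e₃, e₄⟩ := hk _ (hxq j)
    have hz := hzero j hj
    rw [← e₁, ← e₂, ← e₃, ← e₄] at hz
    linear_combination hz

theorem four_le_hammingNorm_of_syndrome_eq_zero {s q i h : ℕ} (hq : q = 3 ^ s) (his : i < s)
    (hh : 2 * h = q - 3 ^ i ∨ 2 * h = 3 ^ i - 1)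
    (hF : Fintype.card F = q) (hK : Fintype.card K = q ^ 2) {ι : Type*} [Fintype ι]
    (hι : 3 ≤ Fintype.card ι)
    [DecidableEq F] {x : ι → K} (hx : Function.Injective x) (hxq : ∀ j, x j ^ (q + 1) = 1)
    {c : ι → F} (hc : syndrome F x h c = 0) (hc0 : c ≠ 0) :
    4 ≤ hammingNorm c := by
  classical
  have : Fact (Nat.Prime 3) := ⟨Nat.prime_three⟩
  have : CharP K 3 := charP_of_card_eq_prime_pow (f := s * 2) (by rw [hK, hq, pow_mul])
  have hQ : 3 ^ i ≤ q := hq ▸ Nat.pow_le_pow_right (by norm_num) his.le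
  by_contra! hlt
  obtain ⟨j₁, hj₁⟩ := Function.ne_iff.1 hc0
  set T : Finset ι := (Finset.univ.filter fun j => c j ≠ 0).erase j₁ with hT
  have hTc : T.card ≤ 2 := by
    rw [hT, Finset.card_erase_of_mem (by simpa using hj₁)]
    have : (Finset.univ.filter fun j => c j ≠ 0).card < 4 := hlt
    omega
  have hTsub : T ⊆ Finset.univ.erase j₁ := Finset.erase_subset_erase _ (Finset.filter_subset _ _)
  obtain ⟨T', hTT', hT', hcard⟩ := Finset.exists_subsuperset_card_eq hTsub hTc
    (by rw [Finset.card_erase_of_mem (Finset.mem_univ _), Finset.card_univ]; omega)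
  obtain ⟨j₂, j₃, -, rfl⟩ := Finset.card_eq_two.1 hcard
  have h₂ : j₂ ≠ j₁ := Finset.ne_of_mem_erase (hT' (by simp))
  have h₃ : j₃ ≠ j₁ := Finset.ne_of_mem_erase (hT' (by simp))
  have hsupp : ∀ j, j ≠ j₁ → c j ≠ 0 → j = j₂ ∨ j = j₃ := by
    intro j hj hcj
    have : j ∈ T := by simp [hT, hj, hcj]
    simpa using hTT' this
  obtain ⟨s₁, s₂⟩ := (syndrome_eq_zero_iff x h c).1 hc
  have conj : ∀ n, ∑ j, algebraMap F K (c j) * x j ^ n = 0 →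
      ∑ j, algebraMap F K (c j) * x j ^ (n * q) = 0 := by
    intro n hn
    have h1 := congrArg (· ^ q) hn
    simp only [hq, sum_pow_char_pow] at h1
    rw [← hq, zero_pow (by rw [hq]; positivity)] at h1
    rw [← h1]
    refine Finset.sum_congr rfl fun j _ => ?_
    rw [mul_pow, ← pow_mul, ← map_pow, ← hF, FiniteField.pow_card]
  have t₁ := conj _ s₁
  have t₂ := conj _ s₂
  obtain ⟨k, hk⟩ : ∃ k, ∑ j, algebraMap F K (c j) * x j ^ k = 0 ∧
      ∑ j, algebraMap F K (c j) * x j ^ (k + 1) = 0 ∧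
      ∑ j, algebraMap F K (c j) * x j ^ (k + 3 ^ i) = 0 ∧
      ∑ j, algebraMap F K (c j) * x j ^ (k + 3 ^ i + 1) = 0 := by
    obtain ⟨k, hk | hk⟩ := exists_exponent_shift K hQ (Nat.one_le_pow _ _ (by norm_num)) hh
    · refine ⟨k, ?_⟩
      simp only [fun j => (hk _ (hxq j)).1, fun j => (hk _ (hxq j)).2.1,
        fun j => (hk _ (hxq j)).2.2.1, fun j => (hk _ (hxq j)).2.2.2]
      exact ⟨t₂, t₁, s₁, s₂⟩
    · refine ⟨k, ?_⟩
      simp only [fun j => (hk _ (hxq j)).1, fun j => (hk _ (hxq j)).2.1,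
        fun j => (hk _ (hxq j)).2.2.1, fun j => (hk _ (hxq j)).2.2.2]
      exact ⟨s₁, s₂, t₂, t₁⟩
  obtain ⟨k₁, k₂, k₃, k₄⟩ := hk
  have hsum : ∑ j, algebraMap F K (c j) * x j ^ k *
      ((x j - x j₂) * (x j - x j₃) ^ 3 ^ i) = 0 := by
    have : ∀ j, algebraMap F K (c j) * x j ^ k * ((x j - x j₂) * (x j - x j₃) ^ 3 ^ i) =
        algebraMap F K (c j) * x j ^ (k + 3 ^ i + 1)
        - x j₂ * (algebraMap F K (c j) * x j ^ (k + 3 ^ i))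
        - x j₃ ^ 3 ^ i * (algebraMap F K (c j) * x j ^ (k + 1))
        + x j₂ * x j₃ ^ 3 ^ i * (algebraMap F K (c j) * x j ^ k) := by
      intro j
      rw [sub_pow_char_pow]
      ring
    simp only [this, Finset.sum_add_distrib, Finset.sum_sub_distrib, ← Finset.mul_sum, k₁, k₂, k₃,
      k₄, mul_zero, sub_zero, add_zero]
  rw [Finset.sum_eq_single j₁] at hsum
  · have hx0 := pow_ne_zero k (ne_zero_of_pow_succ_eq_one (hxq j₁))
    have d₂ := sub_ne_zero.2 (hx.ne h₂.symm)
    have d₃ := pow_ne_zero (3 ^ i) (sub_ne_zero.2 (hx.ne h₃.symm))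
    have hcj : algebraMap F K (c j₁) ≠ 0 := by simpa using hj₁
    exact mul_ne_zero (mul_ne_zero hcj hx0) (mul_ne_zero d₂ d₃) hsum
  · intro j _ hj
    by_cases hcj : c j = 0
    · simp [hcj]
    · rcases hsupp j hj hcj with rfl | rfl <;> simp
  · simp

theorem syndrome_surjective {ι : Type*} [Fintype ι] [DecidableEq ι] {x : ι → K} {h : ℕ}
    (hinj : Function.Injective (traceWord F x h)) : Function.Surjective (syndrome F x h) := by
  rw [← LinearMap.range_eq_top]
  by_contra hne
  obtain ⟨f, hf0, hf⟩ := Submodule.exists_le_ker_of_lt_top _ (lt_top_iff_ne_top.2 hne)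
  have hrep : ∀ g : K →ₗ[F] F, ∃ a : K, ∀ z, g z = Algebra.trace F K (a * z) := fun g =>
    ⟨_, fun z => (LinearMap.BilinForm.apply_toDual_symm_apply
      (hB := traceForm_nondegenerate F K) g z).symm⟩
  obtain ⟨a, ha⟩ := hrep (f.comp (LinearMap.inl F K K))
  obtain ⟨b, hb⟩ := hrep (f.comp (LinearMap.inr F K K))
  have hfab : ∀ u v, f (u, v) = Algebra.trace F K (a * u + b * v) := by
    intro u v
    rw [map_add, ← ha, ← hb, LinearMap.comp_apply, LinearMap.comp_apply, ← map_add]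
    simp
  have hz : traceWord F x h (a, b) = 0 := by
    ext j
    have := hf (LinearMap.mem_range_self (syndrome F x h) (Pi.single j 1))
    simp only [syndrome, Fintype.linearCombination_apply_single, one_smul, LinearMap.mem_ker,
      hfab] at this
    rw [traceWord_apply, this, Pi.zero_apply]
  have hab : (a, b) = (0 : K × K) := hinj (by rw [hz, map_zero])
  rw [Prod.mk_eq_zero] at hab
  apply hf0
  apply LinearMap.ext
  rintro ⟨u, v⟩
  rw [hfab, hab.1, hab.2]
  simp

end BCHCode

theorem stmt7 (s : ℕ) (hs : 1 < s) (q : ℕ) (hq : q = 3 ^ s)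
    (i : ℕ) (hi0 : 0 < i) (his : i < s) (him : Nat.gcd i s = 1)
    (h : ℕ) (hh : 2 * h = q - 3 ^ i ∨ 2 * h = 3 ^ i - 1)
    (F K : Type) [Field F] [Field K] [Fintype F] [Fintype K] [DecidableEq F]
    [Algebra F K] (hF : Fintype.card F = q) (hK : Fintype.card K = q ^ 2)
    (β : K) (hβ : IsPrimitiveRoot β (q + 1))
    (C : Set (Fin (q + 1) → F))
    (hC : C = {c | (∑ j : Fin (q + 1), algebraMap F K (c j) * β ^ (h * (j : ℕ)) = 0) ∧
      (∑ j : Fin (q + 1), algebraMap F K (c j) * β ^ ((h + 1) * (j : ℕ)) = 0)})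
    (D : Set (Fin (q + 1) → F))
    (hD : D = {c | ∃ a b : K, ∀ j : Fin (q + 1),
      c j = Algebra.trace F K (a * β ^ (h * (j : ℕ)) + b * β ^ ((h + 1) * (j : ℕ)))}) :
    C.ncard = q ^ (q - 3) ∧
    IsLeast {w : ℕ | ∃ c ∈ C, c ≠ 0 ∧ hammingNorm c = w} 4 ∧
    D.ncard = q ^ 4 ∧
    IsLeast {w : ℕ | ∃ c ∈ D, c ≠ 0 ∧ hammingNorm c = w} (q - 3) := by
  classical
  have hq9 : 9 ≤ q := by
    rw [hq]
    calc 9 = 3 ^ 2 := by norm_num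
      _ ≤ 3 ^ s := Nat.pow_le_pow_right (by norm_num) hs
  obtain ⟨m, hm⟩ : ∃ m, q + 1 = 2 * m := by
    have : Odd q := hq ▸ Odd.pow (by decide)
    obtain ⟨t, ht⟩ := this
    exact ⟨t + 1, by omega⟩
  have : Fact (Nat.Prime 3) := ⟨Nat.prime_three⟩
  have : CharP F 3 := charP_of_card_eq_prime_pow (hF.trans hq)
  have hCK : CharP K 3 := charP_of_card_eq_prime_pow (f := s * 2) (by rw [hK, hq, pow_mul])
  have h2F : (2 : F) ≠ 0 := Ring.two_ne_zero (by rw [ringChar.eq F 3]; norm_num)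
  obtain ⟨x, hxdef⟩ : ∃ x : Fin (q + 1) → K, ∀ j, x j = β ^ (j : ℕ) := ⟨_, fun _ => rfl⟩
  have hβ1 := hβ.pow_eq_one
  have hx : Function.Injective x := by
    intro j l hjl
    rw [hxdef, hxdef] at hjl
    exact Fin.ext (hβ.pow_inj j.2 l.2 hjl)
  have hxq : ∀ j, x j ^ (q + 1) = 1 := by
    intro j
    rw [hxdef, ← pow_mul, mul_comm, pow_mul, hβ1, one_pow]
  have hpow : ∀ n (j : Fin (q + 1)), β ^ (n * (j : ℕ)) = x j ^ n := by
    intro n j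
    rw [hxdef, ← pow_mul, mul_comm]
  have hC' : ∀ c, c ∈ C ↔ syndrome F x h c = 0 := by
    intro c
    rw [hC, syndrome_eq_zero_iff]
    simp only [hpow, Set.mem_ofPred_eq]
  have hD' : D = Set.range (traceWord F x h) := by
    rw [hD]
    ext c
    simp only [hpow, Set.mem_ofPred_eq, Set.mem_range, Prod.exists, funext_iff, traceWord_apply,
      eq_comm]
  have hzeros : ∀ p : K × K, p ≠ 0 →
      (Finset.univ.filter fun j => traceWord F x h p j = 0).card ≤ 4 := fun p hp =>
    card_traceWord_zeros_le hq his him hh hF hK hx hxq hp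
  have hinj : Function.Injective (traceWord F x h) := by
    rw [← LinearMap.ker_eq_bot, LinearMap.ker_eq_bot']
    intro p hp
    by_contra hp0
    have := hzeros p hp0
    simp [hp] at this
    omega
  obtain ⟨j₀, hj₀⟩ : ∃ j : Fin (q + 1), (j : ℕ) = 0 := ⟨⟨0, by omega⟩, rfl⟩
  obtain ⟨j₁, hj₁⟩ : ∃ j : Fin (q + 1), (j : ℕ) = 1 := ⟨⟨1, by omega⟩, rfl⟩
  obtain ⟨jm, hjm⟩ : ∃ j : Fin (q + 1), (j : ℕ) = m := ⟨⟨m, by omega⟩, rfl⟩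
  obtain ⟨jq, hjq⟩ : ∃ j : Fin (q + 1), (j : ℕ) = q := ⟨⟨q, by omega⟩, rfl⟩
  have x₀ : x j₀ = 1 := by rw [hxdef, hj₀, pow_zero]
  have x₁ : x j₁ = β := by rw [hxdef, hj₁, pow_one]
  have xq : x jq = β ^ q := by rw [hxdef, hjq]
  have xm : x jm = -1 := by
    have h1 : x jm ^ 2 = 1 := by rw [hxdef, hjm, ← pow_mul, mul_comm, ← hm, hβ1]
    rw [sq] at h1
    refine (mul_self_eq_one_iff.1 h1).resolve_left ?_
    rw [← x₀]
    exact hx.ne (by rw [Ne, Fin.ext_iff]; omega)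
  have n₀₁ : j₀ ≠ j₁ := by rw [Ne, Fin.ext_iff]; omega
  have n₀m : j₀ ≠ jm := by rw [Ne, Fin.ext_iff]; omega
  have n₀q : j₀ ≠ jq := by rw [Ne, Fin.ext_iff]; omega
  have n₁m : j₁ ≠ jm := by rw [Ne, Fin.ext_iff]; omega
  have n₁q : j₁ ≠ jq := by rw [Ne, Fin.ext_iff]; omega
  have nmq : jm ≠ jq := by rw [Ne, Fin.ext_iff]; omega
  have hcard4 : ({j₀, j₁, jm, jq} : Finset (Fin (q + 1))).card = 4 := by
    simp [n₀₁, n₀m, n₀q, n₁m, n₁q, nmq]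
  refine ⟨?_, ⟨?_, ?_⟩, ?_, ⟨?_, ?_⟩⟩
  · have hset : C = (LinearMap.ker (syndrome F x h) : Set (Fin (q + 1) → F)) := by
      ext c
      rw [hC', SetLike.mem_coe, LinearMap.mem_ker]
    have hrank := LinearMap.finrank_range_add_finrank_ker (syndrome F x h)
    rw [LinearMap.range_eq_top.2 (syndrome_surjective hinj), finrank_top, Module.finrank_prod,
      finrank_eq_two_of_card hF hK, Module.finrank_fin_fun] at hrank
    rw [hset, ← Nat.card_coe_set_eq, SetLike.coe_sort_coe, Module.natCard_eq_pow_finrank (K := F),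
      Nat.card_eq_fintype_card, hF]
    congr 1
    omega
  · obtain ⟨c, hc⟩ : ∃ c : Fin (q + 1) → F, c =
        Pi.single j₁ 2 + Pi.single jq 2 +
        Pi.single j₀ (-(Algebra.trace F K (β ^ h) + Algebra.trace F K (β ^ (h + 1)))) +
        Pi.single jm ((-1) ^ h * (Algebra.trace F K (β ^ (h + 1)) - Algebra.trace F K (β ^ h))) :=
      ⟨_, rfl⟩
    have hcC : syndrome F x h c = 0 := by
      have hs : ((-1 : K) ^ h) * (-1) ^ h = 1 := by rw [← mul_pow]; simp
      rw [hc, map_add, map_add, map_add]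
      simp only [syndrome, Fintype.linearCombination_apply_single, x₀, x₁, xq, xm]
      simp only [Prod.smul_mk, Prod.mk_add_mk, Prod.mk_eq_zero]
      simp only [Algebra.smul_def, map_neg, map_add, map_mul, map_sub, map_pow, map_one,
        map_ofNat, algebraMap_trace_of_card_sq hF hK, one_pow,
        pow_right_comm β q]
      constructor
      · linear_combination (β ^ (h + 1) + (β ^ (h + 1)) ^ q - β ^ h - (β ^ h) ^ q) * hs
      · rw [pow_succ (-1 : K) h]
        linear_combination (-(β ^ (h + 1) + (β ^ (h + 1)) ^ q - β ^ h - (β ^ h) ^ q)) * hs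
    have hc0 : c ≠ 0 := by
      intro h0
      have := congrFun h0 j₁
      rw [hc] at this
      simp [n₀₁.symm, n₁m, n₁q, h2F] at this
    refine ⟨c, (hC' c).2 hcC, hc0, le_antisymm ?_ ?_⟩
    · rw [← hcard4]
      refine Finset.card_le_card fun j hj => ?_
      by_contra hnot
      simp only [Finset.mem_insert, Finset.mem_singleton, not_or] at hnot
      rw [Finset.mem_filter, hc] at hj
      simp [hnot] at hj
    · exact four_le_hammingNorm_of_syndrome_eq_zero hq his hh hF hK
        (by rw [Fintype.card_fin]; omega) hx hxq hcC hc0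
  · rintro w ⟨c, hcC, hc0, rfl⟩
    exact four_le_hammingNorm_of_syndrome_eq_zero hq his hh hF hK
      (by rw [Fintype.card_fin]; omega) hx hxq ((hC' c).1 hcC) hc0
  · rw [hD', Set.ncard_range_of_injective hinj, Nat.card_prod, Nat.card_eq_fintype_card, hK]
    ring
  · have hqq : ∀ z : K, (z ^ q) ^ q = z := fun z => by
      rw [← pow_mul, ← sq, ← hK, FiniteField.pow_card]
    obtain ⟨ε, hε⟩ : ∃ ε, ε = β - β ^ q := ⟨_, rfl⟩
    have hε0 : ε ≠ 0 := by
      rw [hε, ← xq, ← x₁]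
      exact sub_ne_zero.2 (hx.ne n₁q)
    have hεq : ε ^ q = -ε := by
      have : (β - β ^ q) ^ q = β ^ q - (β ^ q) ^ q := by
        simp only [hq]
        exact sub_pow_char_pow _ _ _
      rw [hε, this, hqq]
      ring
    have hεtr : Algebra.trace F K ε = 0 := by
      apply (algebraMap F K).injective
      rw [algebraMap_trace_of_card_sq hF hK, hεq, map_zero, add_neg_cancel]
    obtain ⟨a, b, hab, hlin⟩ : ∃ a b : F, ¬ (a = 0 ∧ b = 0) ∧
        a * Algebra.trace F K (ε * β ^ h) + b * Algebra.trace F K (ε * β ^ (h + 1)) = 0 := by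
      by_cases h0 : Algebra.trace F K (ε * β ^ h) = 0
      · exact ⟨1, 0, by simp, by simp [h0]⟩
      · exact ⟨-Algebra.trace F K (ε * β ^ (h + 1)), Algebra.trace F K (ε * β ^ h),
          fun h => h0 h.2, by ring⟩
    obtain ⟨p, hp⟩ : ∃ p : K × K, p = (a • ε, b • ε) := ⟨_, rfl⟩
    have hp0 : p ≠ 0 := by
      rw [hp, Ne, Prod.mk_eq_zero, smul_eq_zero_iff_left hε0, smul_eq_zero_iff_left hε0]
      exact hab
    have hw : ∀ j, traceWord F x h p j =
        a * Algebra.trace F K (ε * x j ^ h) + b * Algebra.trace F K (ε * x j ^ (h + 1)) := by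
      intro j
      rw [traceWord_apply, hp]
      simp
    have hneg : ∀ n, Algebra.trace F K (ε * (-1) ^ n) = 0 := by
      intro n
      rcases neg_one_pow_eq_or K n with h1 | h1 <;> simp [h1, hεtr]
    have hconj : ∀ n, Algebra.trace F K (ε * (β ^ q) ^ n) = -Algebra.trace F K (ε * β ^ n) := by
      intro n
      rw [← trace_pow_of_card_sq hF hK (ε * β ^ n), mul_pow, hεq, pow_right_comm, neg_mul, map_neg,
        neg_neg]
    have hsub : ({j₀, j₁, jm, jq} : Finset (Fin (q + 1))) ⊆
        Finset.univ.filter fun j => traceWord F x h p j = 0 := by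
      intro j hj
      simp only [Finset.mem_insert, Finset.mem_singleton] at hj
      rw [Finset.mem_filter]
      refine ⟨Finset.mem_univ _, ?_⟩
      rw [hw]
      rcases hj with rfl | rfl | rfl | rfl
      · simp [x₀, hεtr]
      · rw [x₁, hlin]
      · simp [xm, hneg]
      · rw [xq, hconj, hconj]
        linear_combination -hlin
    have h4 := Finset.card_le_card hsub
    rw [hcard4] at h4
    have h5 := hzeros p hp0
    have hsum := hammingNorm_add_card_zeros (traceWord F x h p)
    rw [Fintype.card_fin] at hsum
    refine ⟨traceWord F x h p, hD' ▸ Set.mem_range_self p, ?_, by omega⟩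
    rw [← map_zero (traceWord F x h)]
    exact hinj.ne hp0
  · rintro w ⟨c, hcD, hc0, rfl⟩
    rw [hD'] at hcD
    obtain ⟨p, rfl⟩ := hcD
    have h5 := hzeros p (by rintro rfl; exact hc0 (map_zero _))
    have hsum := hammingNorm_add_card_zeros (traceWord F x h p)
    rw [Fintype.card_fin] at hsum
    omega
end
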